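/- arXiv:1104.5439 — 3 statements merged into one kernel-verified Lean document; each statement's English description precedes it below -/
import Mathlib

section
/- With T₊ and T₋ the transition matrices defined from the expansions u_j(x) = Σ_{k=1}^{N} t_{j,k} p_k e^{ζ_k x} valid for x > a when j = 1, …, n and for x < −a when j = n+1, …, N (T₊ = (t_{j,k})_{1≤j,k≤n}, T₋ = (t_{j,k})_{n+1≤j,k≤N}), one has det T₊ = exp(∫_{−∞}^{∞} tr V(y) dy) · det T₋. -/
open MeasureTheory Filter Topology

noncomputable section

/-- A (continuous, integrated-sense) solution of the first order system `u' = L(x) u`. -/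
def IsSolV (N : ℕ) (L : ℝ → Matrix (Fin N) (Fin N) ℂ) (u : ℝ → Fin N → ℂ) : Prop :=
  Continuous u ∧ ∀ x₀ x : ℝ, u x = u x₀ + ∫ y in x₀..x, (L y).mulVec (u y)

/-- A Lipschitz function of an absolutely continuous function is absolutely continuous. -/
theorem LipschitzOnWith.comp_absolutelyContinuousOnInterval
    {X Y : Type*} [PseudoMetricSpace X] [PseudoMetricSpace Y] {K : NNReal} {g : X → Y} {s : Set X}
    (hg : LipschitzOnWith K g s) {f : ℝ → X} {a b : ℝ}
    (hf : AbsolutelyContinuousOnInterval f a b) (hfs : Set.MapsTo f (Set.uIcc a b) s) :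
    AbsolutelyContinuousOnInterval (fun x => g (f x)) a b := by
  unfold AbsolutelyContinuousOnInterval at hf ⊢
  refine squeeze_zero' (.of_forall fun _ => Finset.sum_nonneg fun _ _ => dist_nonneg) ?_
    (by simpa using hf.const_mul (K : ℝ))
  rw [eventually_inf_principal]
  filter_upwards with E hE
  rw [Finset.mul_sum]
  exact Finset.sum_le_sum fun i hi =>
    hg.dist_le_mul _ (hfs (hE.1 i hi).1) _ (hfs (hE.1 i hi).2)

theorem absolutelyContinuousOnInterval_const {X : Type*} [PseudoMetricSpace X] (z : X) (a b : ℝ) :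
    AbsolutelyContinuousOnInterval (fun _ => z) a b :=
  ((LipschitzWith.const z).lipschitzOnWith (s := Set.uIcc a b)).absolutelyContinuousOnInterval

theorem AbsolutelyContinuousOnInterval.finset_prod {ι : Type*} (s : Finset ι) {f : ι → ℝ → ℂ}
    {a b : ℝ} (hf : ∀ i, AbsolutelyContinuousOnInterval (f i) a b) :
    AbsolutelyContinuousOnInterval (fun x => ∏ i ∈ s, f i x) a b := by
  classical
  induction s using Finset.induction_on with
  | empty => simpa using absolutelyContinuousOnInterval_const (1 : ℂ) a b
  | insert i s hi ih => simpa [Finset.prod_insert hi] using (hf i).fun_smul ih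

theorem AbsolutelyContinuousOnInterval.finset_sum {ι : Type*} (s : Finset ι) {f : ι → ℝ → ℂ}
    {a b : ℝ} (hf : ∀ i, AbsolutelyContinuousOnInterval (f i) a b) :
    AbsolutelyContinuousOnInterval (fun x => ∑ i ∈ s, f i x) a b := by
  classical
  induction s using Finset.induction_on with
  | empty => simpa using absolutelyContinuousOnInterval_const (0 : ℂ) a b
  | insert i s hi ih => simpa [Finset.sum_insert hi] using (hf i).fun_add ih

theorem AbsolutelyContinuousOnInterval.matrix_det {ι : Type*} [Fintype ι] [DecidableEq ι]
    {U : ℝ → Matrix ι ι ℂ} {a b : ℝ}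
    (hU : ∀ i j, AbsolutelyContinuousOnInterval (fun x => U x i j) a b) :
    AbsolutelyContinuousOnInterval (fun x => (U x).det) a b := by
  simp only [Matrix.det_apply']
  refine .finset_sum _ fun σ => ?_
  have hprod : AbsolutelyContinuousOnInterval (fun x => ∏ i, U x (σ i) i) a b :=
    .finset_prod (f := fun i x => U x (σ i) i) _ fun i => hU _ _
  exact (absolutelyContinuousOnInterval_const (((Equiv.Perm.sign σ : ℤ)) : ℂ) a b).fun_smul hprod

theorem AbsolutelyContinuousOnInterval.cexp {f : ℝ → ℂ} {a b : ℝ}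
    (hf : AbsolutelyContinuousOnInterval f a b) :
    AbsolutelyContinuousOnInterval (fun x => Complex.exp (f x)) a b := by
  obtain ⟨C, hC⟩ := hf.exists_bound
  have hexp : ContDiff ℝ 1 Complex.exp := Complex.contDiff_exp
  obtain ⟨K, hK⟩ := hexp.contDiffOn.exists_lipschitzOnWith one_ne_zero
    (convex_closedBall (0 : ℂ) C) (isCompact_closedBall 0 C)
  exact hK.comp_absolutelyContinuousOnInterval hf fun x hx => by simpa using hC x hx

theorem MeasureTheory.LocallyIntegrable.intervalIntegrable' {E : Type*} [NormedAddCommGroup E]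
    {f : ℝ → E} (hf : LocallyIntegrable f) (a b : ℝ) : IntervalIntegrable f volume a b :=
  (hf.integrableOn_isCompact isCompact_uIcc).intervalIntegrable

theorem MeasureTheory.LocallyIntegrable.absolutelyContinuousOnInterval_integral {f : ℝ → ℂ}
    (hf : LocallyIntegrable f) (a b : ℝ) :
    AbsolutelyContinuousOnInterval (fun x => ∫ y in a..x, f y) a b := by
  have hi := hf.intervalIntegrable'
  have ofReal_ac {g : ℝ → ℝ} (hg : AbsolutelyContinuousOnInterval g a b) :
      AbsolutelyContinuousOnInterval (fun x => (g x : ℂ)) a b :=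
    Complex.isometry_ofReal.lipschitz.lipschitzOnWith.comp_absolutelyContinuousOnInterval hg
      (Set.mapsTo_univ _ _)
  have hre : IntervalIntegrable (fun y => (f y).re) volume a b := ⟨(hi a b).1.re, (hi a b).2.re⟩
  have him : IntervalIntegrable (fun y => (f y).im) volume a b := ⟨(hi a b).1.im, (hi a b).2.im⟩
  have hsum (x : ℝ) : ∫ y in a..x, f y =
      ((∫ y in a..x, (f y).re : ℝ) : ℂ) + ((∫ y in a..x, (f y).im : ℝ) : ℂ) • Complex.I := by
    have h1 := Complex.reCLM.intervalIntegral_comp_comm (hi a x)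
    have h2 := Complex.imCLM.intervalIntegral_comp_comm (hi a x)
    simp only [Complex.reCLM_apply, Complex.imCLM_apply] at h1 h2
    rw [h1, h2, smul_eq_mul, Complex.re_add_im]
  rw [funext hsum]
  exact (ofReal_ac (hre.absolutelyContinuousOnInterval_intervalIntegral
    Set.left_mem_uIcc)).fun_add ((ofReal_ac (him.absolutelyContinuousOnInterval_intervalIntegral
    Set.left_mem_uIcc)).fun_smul (absolutelyContinuousOnInterval_const Complex.I a b))

theorem MeasureTheory.LocallyIntegrable.mul_continuous' {f g : ℝ → ℂ} (hf : LocallyIntegrable f)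
    (hg : Continuous g) : LocallyIntegrable fun x => f x * g x :=
  locallyIntegrable_iff.2 fun _ hk =>
    (hf.integrableOn_isCompact hk).mul_continuousOn hg.continuousOn hk

theorem MeasureTheory.LocallyIntegrable.finset_sum' {ι : Type*} (s : Finset ι) {f : ι → ℝ → ℂ}
    (hf : ∀ i, LocallyIntegrable (f i)) : LocallyIntegrable fun x => ∑ i ∈ s, f i x :=
  locallyIntegrable_iff.2 fun _ hk =>
    integrable_finsetSum _ fun i _ => (hf i).integrableOn_isCompact hk

/-- Jacobi's formula along a curve satisfying `U' = A U` at a point. -/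
theorem hasDerivAt_det_of_mul {ι : Type*} [Fintype ι] [DecidableEq ι]
    {U : ℝ → Matrix ι ι ℂ} {A : Matrix ι ι ℂ} {x : ℝ}
    (hU : ∀ i j, HasDerivAt (fun y => U y i j) ((A * U x) i j) x) :
    HasDerivAt (fun y => (U y).det) (A.trace * (U x).det) x := by
  let D : ContinuousMultilinearMap ℝ (fun _ : ι => ι → ℂ) ℂ :=
    { (Matrix.detRowAlternating (n := ι) (R := ℂ)).toMultilinearMap.restrictScalars ℝ with
      cont := continuous_id.matrix_det }
  have hrow : HasFDerivAt (fun y i => U y i)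
      ((1 : ℝ →L[ℝ] ℝ).smulRight (fun i => (A * U x) i)) x :=
    (hasDerivAt_pi.2 fun i => hasDerivAt_pi.2 fun j => hU i j).hasFDerivAt
  have h := ((D.hasFDerivAt (fun i => U x i)).comp x hrow).hasDerivAt
  refine h.congr_deriv ?_
  have hD (M : ι → ι → ℂ) : D M = (Matrix.of M).det := rfl
  simp only [ContinuousLinearMap.comp_apply, ContinuousLinearMap.smulRight_apply,
    one_apply_eq_self, one_smul, ContinuousMultilinearMap.linearDeriv_apply, hD]
  rw [Matrix.trace, Finset.sum_mul]
  refine Finset.sum_congr rfl fun i _ => ?_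
  have hi : (A * U x) i = ∑ k, A i k • U x k := by
    ext j
    simp [Matrix.mul_apply]
  rw [hi]
  exact Matrix.det_updateRow_sum (U x) i (A i)

/-- Liouville's formula for linear systems with locally integrable coefficients. -/
theorem det_eq_det_mul_exp_integral_trace {ι : Type*} [Fintype ι] [DecidableEq ι]
    {A U : ℝ → Matrix ι ι ℂ} (hA : ∀ i j, LocallyIntegrable fun x => A x i j)
    (hcont : ∀ i j, Continuous fun x => U x i j)
    (hU : ∀ i j x₀ x, U x i j = U x₀ i j + ∫ y in x₀..x, (A y * U y) i j) (c d : ℝ) :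
    (U d).det = (U c).det * Complex.exp (∫ y in c..d, (A y).trace) := by
  have hAU (i j) : LocallyIntegrable fun y => (A y * U y) i j := by
    simp only [Matrix.mul_apply]
    exact .finset_sum' _ fun k => (hA i k).mul_continuous' (hcont k j)
  have htr : LocallyIntegrable fun y => (A y).trace := by
    simp only [Matrix.trace, Matrix.diag]
    exact .finset_sum' _ fun k => hA k k
  have hUac (i j) : AbsolutelyContinuousOnInterval (fun x => U x i j) c d := by
    rw [funext (hU i j c)]
    exact (absolutelyContinuousOnInterval_const _ c d).fun_add
      ((hAU i j).absolutelyContinuousOnInterval_integral c d)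
  have hac := (AbsolutelyContinuousOnInterval.matrix_det hUac).fun_smul
    (htr.absolutelyContinuousOnInterval_integral c d).fun_neg.cexp
  obtain ⟨C, hC⟩ := hac.const_of_ae_hasDerivAt_zero <| by
    filter_upwards [LocallyIntegrable.ae_hasDerivAt_integral htr, ae_all_iff.2 fun i =>
      ae_all_iff.2 fun j => LocallyIntegrable.ae_hasDerivAt_integral (hAU i j)] with x htrx hUx _
    have hdet := hasDerivAt_det_of_mul (U := U) (A := A x) (x := x) fun i j => by
      refine ((hUx i j c).const_add (U c i j)).congr_of_eventuallyEq (.of_forall fun y => ?_)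
      exact hU i j c y
    refine (hdet.mul (htrx c).neg.cexp).congr_deriv ?_
    ring
  have h := (hC d Set.right_mem_uIcc).trans (hC c Set.left_mem_uIcc).symm
  simp only [smul_eq_mul, intervalIntegral.integral_same, neg_zero, Complex.exp_zero, mul_one] at h
  rw [← h, mul_assoc, ← Complex.exp_add, neg_add_cancel, Complex.exp_zero, mul_one]

theorem MeasureTheory.LocallyIntegrable.const_add' {f : ℝ → ℂ} (z : ℂ)
    (hf : LocallyIntegrable f) : LocallyIntegrable fun x => z + f x :=
  (locallyIntegrable_const z).add hf

theorem integral_mulVec_apply {ι : Type*} [Fintype ι] {A : ℝ → Matrix ι ι ℂ} {v : ℝ → ι → ℂ}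
    (hA : ∀ i j, LocallyIntegrable fun x => A x i j) (hv : Continuous v) (a b : ℝ) (i : ι) :
    (∫ y in a..b, (A y).mulVec (v y)) i = ∫ y in a..b, (A y).mulVec (v y) i := by
  have hloc (i) : LocallyIntegrable fun y => (A y).mulVec (v y) i := by
    simp only [Matrix.mulVec, dotProduct]
    exact .finset_sum' _ fun k => (hA i k).mul_continuous' ((continuous_apply k).comp hv)
  have hint : IntervalIntegrable (fun y => (A y).mulVec (v y)) volume a b :=
    ⟨Integrable.of_eval fun i => ((hloc i).intervalIntegrable' a b).1,
      Integrable.of_eval fun i => ((hloc i).intervalIntegrable' a b).2⟩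
  exact ((ContinuousLinearMap.proj (R := ℝ) (φ := fun _ : ι => ℂ) i).intervalIntegral_comp_comm
    hint).symm

theorem det_of_eigenvectors_ne_zero {ι : Type*} [Fintype ι] [DecidableEq ι]
    {L₀ : Matrix ι ι ℂ} {ζ : ι → ℂ} {p : ι → ι → ℂ} (hdist : Function.Injective ζ)
    (heig : ∀ j, L₀.mulVec (p j) = ζ j • p j) (hp0 : ∀ j, p j ≠ 0) : (Matrix.of p).det ≠ 0 := by
  have hli : LinearIndependent ℂ p :=
    Module.End.eigenvectors_linearIndependent' (Matrix.toLin' L₀) ζ hdist p fun j =>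
      Module.End.hasEigenvector_iff.2
        ⟨Module.End.mem_eigenspace_iff.2 (by simpa using heig j), hp0 j⟩
  have hu : IsUnit (Matrix.of p) := Matrix.linearIndependent_rows_iff_isUnit.1 hli
  exact ((Matrix.isUnit_iff_isUnit_det _).1 hu).ne_zero

theorem trace_eq_sum_of_eigenvectors {ι : Type*} [Fintype ι] [DecidableEq ι]
    {L₀ : Matrix ι ι ℂ} {ζ : ι → ℂ} {p : ι → ι → ℂ}
    (heig : ∀ j, L₀.mulVec (p j) = ζ j • p j) (hdet : (Matrix.of p).det ≠ 0) :
    L₀.trace = ∑ j, ζ j := by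
  have hP : IsUnit (Matrix.of p).transpose.det := by
    rw [Matrix.det_transpose]
    exact hdet.isUnit
  have hmul : L₀ * (Matrix.of p).transpose = (Matrix.of p).transpose * Matrix.diagonal ζ := by
    ext i j
    have := congrFun (heig j) i
    rw [Matrix.mul_diagonal]
    simpa [Matrix.mul_apply, Matrix.mulVec, dotProduct, mul_comm] using this
  rw [← Matrix.mul_nonsing_inv_cancel_right (A := (Matrix.of p).transpose) L₀ hP, hmul, Matrix.mul_assoc,
    Matrix.trace_mul_comm, Matrix.mul_assoc, Matrix.nonsing_inv_mul _ hP, Matrix.mul_one,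
    Matrix.trace_diagonal]

/-- The determinant of vectors with coefficients `C` in the modes `exp (ζ k * x) • p k`. -/
theorem det_of_mode_expansion {ι : Type*} [Fintype ι] [DecidableEq ι] {ζ : ι → ℂ}
    {p : ι → ι → ℂ} {C W : Matrix ι ι ℂ} {x : ℝ}
    (hW : ∀ j k, W k j = (∑ l, (C j l * Complex.exp (ζ l * x)) • p l) k) :
    W.det = C.det * Complex.exp ((∑ j, ζ j) * x) * (Matrix.of p).det := by
  have h : W.transpose = C * Matrix.diagonal (fun l => Complex.exp (ζ l * x)) * Matrix.of p := by
    ext j k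
    rw [Matrix.mul_apply]
    simp [hW, Matrix.mul_diagonal]
  rw [← Matrix.det_transpose, h, Matrix.det_mul, Matrix.det_mul, Matrix.det_diagonal,
    ← Complex.exp_sum, Finset.sum_mul]

/-- with `T₊` and `T₋` the transition matrices,
`det T₊ = exp(∫_{−∞}^{∞} tr V(y) dy) · det T₋`. -/
theorem statement_4 (N n : ℕ) (hN : 1 ≤ N) (hn : n ≤ N)
    (L₀ : Matrix (Fin N) (Fin N) ℂ) (ζ : Fin N → ℂ) (p : Fin N → Fin N → ℂ)
    (hdist : Function.Injective ζ)
    (heig : ∀ j, L₀.mulVec (p j) = ζ j • p j) (hp0 : ∀ j, p j ≠ 0)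
    (hre : ∀ j, (ζ j).re ≠ 0)
    (hpos : ∀ j : Fin N, (j : ℕ) < n → 0 < (ζ j).re)
    (hneg : ∀ j : Fin N, n ≤ (j : ℕ) → (ζ j).re < 0)
    (a : ℝ) (ha : 0 < a)
    (V : ℝ → Matrix (Fin N) (Fin N) ℂ)
    (hVloc : ∀ i j : Fin N, MeasureTheory.LocallyIntegrable fun x : ℝ => V x i j)
    (hVsupp : ∀ x : ℝ, x ∉ Set.Icc (-a) a → V x = 0)
    (u : Fin N → ℝ → Fin N → ℂ)
    (husol : ∀ j, IsSolV N (fun x => L₀ + V x) (u j))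
    (hbcm : ∀ j : Fin N, (j : ℕ) < n → ∀ x : ℝ, x < -a → u j x = Complex.exp (ζ j * x) • p j)
    (hbcp : ∀ j : Fin N, n ≤ (j : ℕ) → ∀ x : ℝ, x > a → u j x = Complex.exp (ζ j * x) • p j)
    (U : ℝ → Matrix (Fin N) (Fin N) ℂ)
    (hU : ∀ x, U x = Matrix.of fun k j => u j x k)
    (t : Fin N → Fin N → ℂ)
    (htp : ∀ j : Fin N, (j : ℕ) < n → ∀ x : ℝ, x > a →
      u j x = ∑ k : Fin N, (t j k * Complex.exp (ζ k * x)) • p k)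
    (htm : ∀ j : Fin N, n ≤ (j : ℕ) → ∀ x : ℝ, x < -a →
      u j x = ∑ k : Fin N, (t j k * Complex.exp (ζ k * x)) • p k)
    (Tp : Matrix (Fin n) (Fin n) ℂ)
    (hTp : Tp = Matrix.of fun j k : Fin n =>
      t ⟨j, lt_of_lt_of_le j.2 hn⟩ ⟨k, lt_of_lt_of_le k.2 hn⟩)
    (Tm : Matrix (Fin (N - n)) (Fin (N - n)) ℂ)
    (hTm : Tm = Matrix.of fun j k : Fin (N - n) =>
      t ⟨n + j, by omega⟩ ⟨n + k, by omega⟩)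
    :
    Tp.det = Complex.exp (∫ y : ℝ, (V y).trace) * Tm.det := by
  have hA (i j) : LocallyIntegrable fun x => (L₀ + V x) i j := (hVloc i j).const_add' (L₀ i j)
  have hcont (i j) : Continuous fun x => U x i j := by
    simp only [hU, Matrix.of_apply]
    exact (continuous_apply i).comp (husol j).1
  have hint (i j x₀ x) : U x i j = U x₀ i j + ∫ y in x₀..x, ((L₀ + V y) * U y) i j := by
    have h := congrFun ((husol j).2 x₀ x) i
    rw [Pi.add_apply, integral_mulVec_apply hA (husol j).1] at h
    simpa [hU, Matrix.mul_apply, Matrix.mulVec, dotProduct] using h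
  have hdet := det_eq_det_mul_exp_integral_trace hA hcont hint (-(a + 1)) (a + 1)
  have hp := det_of_eigenvectors_ne_zero hdist heig hp0
  have htr : LocallyIntegrable fun y => (V y).trace := by
    simp only [Matrix.trace, Matrix.diag]
    exact .finset_sum' _ fun k => hVloc k k
  have hV : ∫ y in -(a + 1)..(a + 1), (V y).trace = ∫ y, (V y).trace := by
    refine intervalIntegral.integral_eq_integral_of_support_subset fun y hy => ?_
    by_contra hya
    refine hy ?_
    change (V y).trace = 0
    rw [hVsupp y fun h => hya ⟨by linarith [h.1], by linarith [h.2]⟩, Matrix.trace_zero]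
  have htrace : ∫ y in -(a + 1)..(a + 1), (L₀ + V y).trace =
      (∑ j, ζ j) * (a + 1 : ℝ) - (∑ j, ζ j) * (-(a + 1) : ℝ) + ∫ y, (V y).trace := by
    simp only [Matrix.trace_add]
    rw [intervalIntegral.integral_add intervalIntegrable_const (htr.intervalIntegrable' _ _), hV,
      intervalIntegral.integral_const, trace_eq_sum_of_eigenvectors heig hp, Complex.real_smul]
    push_cast
    ring
  let e : Fin n ⊕ Fin (N - n) ≃ Fin N := finSumFinEquiv.trans (finCongr (by omega))
  have hel (k : Fin n) : e (.inl k) = ⟨k, lt_of_lt_of_le k.2 hn⟩ := rfl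
  have her (k : Fin (N - n)) : e (.inr k) = ⟨n + k, by omega⟩ := rfl
  let Cp : Matrix (Fin N) (Fin N) ℂ :=
    .of fun j => if (j : ℕ) < n then t j else Pi.single j 1
  let Cm : Matrix (Fin N) (Fin N) ℂ :=
    .of fun j => if (j : ℕ) < n then Pi.single j 1 else t j
  have hCp : Cp.det = Tp.det := by
    have h : Cp.submatrix e e =
        .fromBlocks Tp (.of fun j k => t (e (.inl j)) (e (.inr k))) 0 1 := by
      ext (j | j) (k | k)
      · simp [Cp, hel, hTp]
      · simp [Cp, hel]
      · simp [Cp, hel, her, Pi.single_apply, Fin.ext_iff]; omega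
      · simp [Cp, her, Pi.single_apply, Matrix.one_apply, Fin.ext_iff, eq_comm]
    rw [← Matrix.det_submatrix_equiv_self e, h, Matrix.det_fromBlocks_zero₂₁, Matrix.det_one,
      mul_one]
  have hCm : Cm.det = Tm.det := by
    have h : Cm.submatrix e e =
        .fromBlocks 1 0 (.of fun j k => t (e (.inr j)) (e (.inl k))) Tm := by
      ext (j | j) (k | k)
      · simp [Cm, hel, Pi.single_apply, Matrix.one_apply, Fin.ext_iff, eq_comm]
      · simp [Cm, hel, her, Pi.single_apply, Fin.ext_iff]; omega
      · simp [Cm, her]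
      · simp [Cm, her, hTm]
    rw [← Matrix.det_submatrix_equiv_self e, h, Matrix.det_fromBlocks_zero₁₂, Matrix.det_one,
      one_mul]
  have hUp := det_of_mode_expansion (ζ := ζ) (p := p) (C := Cp) (W := U (a + 1)) (x := a + 1)
    fun j k => by
      by_cases hj : (j : ℕ) < n
      · simp only [hU, Matrix.of_apply, Cp, if_pos hj]
        rw [htp j hj (a + 1) (by linarith)]
      · simp only [hU, Matrix.of_apply, Cp, if_neg hj]
        rw [hbcp j (not_lt.1 hj) (a + 1) (by linarith)]
        simp [Pi.single_apply, ite_apply]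
  have hUm := det_of_mode_expansion (ζ := ζ) (p := p) (C := Cm) (W := U (-(a + 1)))
    (x := -(a + 1)) fun j k => by
      by_cases hj : (j : ℕ) < n
      · simp only [hU, Matrix.of_apply, Cm, if_pos hj]
        rw [hbcm j hj (-(a + 1)) (by linarith)]
        simp [Pi.single_apply, ite_apply]
      · simp only [hU, Matrix.of_apply, Cm, if_neg hj]
        rw [htm j (not_lt.1 hj) (-(a + 1)) (by linarith)]
  rw [hUp, hUm, hCp, hCm, htrace, Complex.exp_add, Complex.exp_sub] at hdet
  have h1 := Complex.exp_ne_zero ((∑ j, ζ j) * (a + 1 : ℝ))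
  have h2 := Complex.exp_ne_zero ((∑ j, ζ j) * (-(a + 1) : ℝ))
  field_simp at hdet
  linear_combination hdet
end
end

section
/- Define the matrix-valued kernel R(x,y) = −U(x) P₊ U(y)⁻¹ for x ≤ y and R(x,y) = U(x) P₋ U(y)⁻¹ for x > y. Then there exists a constant C such that ‖R(x,y)‖ ≤ C e^{−ρ|x−y|} for all x, y ∈ ℝ, where ρ = min(ρ₊, ρ₋). -/
open MeasureTheory Filter Topology

noncomputable section

attribute [local instance] Matrix.normedAddCommGroup

/-- A continuous function on the line that is constant near `±∞` is bounded. -/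
lemma exists_norm_bound_of_eventually_const {E : Type*} [NormedAddCommGroup E] {f : ℝ → E}
    (hf : Continuous f) {a : ℝ} {cp cm : E} (hp : ∀ x, a < x → f x = cp)
    (hm : ∀ x, x < -a → f x = cm) : ∃ B : ℝ, ∀ x, ‖f x‖ ≤ B := by
  obtain ⟨B, hB⟩ := (isCompact_Icc (a := -a) (b := a)).exists_bound_of_continuousOn
    hf.continuousOn
  refine ⟨max B (max ‖cp‖ ‖cm‖), fun x => ?_⟩
  by_cases h1 : a < x
  · rw [hp x h1]; simp
  by_cases h2 : x < -a
  · rw [hm x h2]; simp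
  exact (hB x ⟨not_lt.1 h2, not_lt.1 h1⟩).trans (le_max_left _ _)

/-- The diagonal projection onto the coordinates satisfying `s`. -/
def coordProj {ι : Type*} [DecidableEq ι] (s : ι → Prop) [DecidablePred s] : Matrix ι ι ℂ :=
  Matrix.diagonal fun j => if s j then 1 else 0

lemma coordProj_add_not {ι : Type*} [DecidableEq ι] {s : ι → Prop} [DecidablePred s] :
    coordProj s + coordProj (fun j => ¬ s j) = 1 := by
  ext j k
  by_cases hjk : j = k
  · subst hjk
    by_cases hj : s j <;> simp [coordProj, hj]
  · simp [coordProj, hjk]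

section coordProj

variable {ι : Type*} [Fintype ι] [DecidableEq ι] (s : ι → Prop) [DecidablePred s]

lemma mul_coordProj_apply (T : Matrix ι ι ℂ) (j k : ι) :
    (T * coordProj s) j k = if s k then T j k else 0 := by
  simp [coordProj, Matrix.mul_diagonal]

lemma coordProj_mul_apply (T : Matrix ι ι ℂ) (j k : ι) :
    (coordProj s * T) j k = if s j then T j k else 0 := by
  simp [coordProj, Matrix.diagonal_mul]

variable {s}

lemma mul_coordProj_eq {T : Matrix ι ι ℂ}
    (h : ∀ j k, s k → T j k = (1 : Matrix ι ι ℂ) j k) : T * coordProj s = coordProj s := by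
  have h1 : (1 : Matrix ι ι ℂ) * coordProj s = coordProj s := one_mul _
  rw [← h1, ← Matrix.mul_assoc, mul_one]
  ext j k
  rw [mul_coordProj_apply, mul_coordProj_apply]
  split_ifs with hk
  · exact h j k hk
  · rfl

lemma inv_mul_of_mul_eq {T A : Matrix ι ι ℂ} (hT : IsUnit T.det) (h : T * A = A) :
    T⁻¹ * A = A := by
  conv_lhs => rw [← h]
  rw [← Matrix.mul_assoc, Matrix.nonsing_inv_mul _ hT, one_mul]

/-- Column `k` of `T⁻¹` is a unit vector if column `k` of `T` is. -/
lemma inv_apply_of_col {T : Matrix ι ι ℂ} (hT : IsUnit T.det)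
    (h : ∀ j k, s k → T j k = (1 : Matrix ι ι ℂ) j k) {j k : ι} (hk : s k) :
    T⁻¹ j k = (1 : Matrix ι ι ℂ) j k := by
  have h1 := congrFun (congrFun (inv_mul_of_mul_eq hT (mul_coordProj_eq h)) j) k
  rw [mul_coordProj_apply, if_pos hk] at h1
  rw [h1, ← one_mul (coordProj s), mul_coordProj_apply, if_pos hk]

/-- Exponential bound for a dichotomy kernel written in exponential coordinates. -/
lemma exists_bound_dichotomy {κ : ι → ℝ} {ρ a : ℝ} (hρ : 0 ≤ ρ) (ha : 0 < a)
    (hs : ∀ j, s j → ρ ≤ κ j) (hns : ∀ j, ¬ s j → κ j ≤ -ρ)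
    {G : ℝ → Matrix ι ι ℂ} (hG : Continuous G) (hdet : ∀ x, (G x).det ≠ 0)
    {Tp Tm : Matrix ι ι ℂ} (hGp : ∀ x, a < x → G x = Tp) (hGm : ∀ x, x < -a → G x = Tm)
    (hTp : ∀ j k, ¬ s k → Tp j k = (1 : Matrix ι ι ℂ) j k)
    (hTm : ∀ j k, s k → Tm j k = (1 : Matrix ι ι ℂ) j k) :
    ∃ C : ℝ, 0 ≤ C ∧ ∀ x y, x ≤ y → ∀ j k,
      Real.exp (κ j * x - κ k * y) * ‖(G x * coordProj s * (G y)⁻¹) j k‖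
        ≤ C * Real.exp (-ρ * (y - x)) := by
  have hTpu : IsUnit Tp.det := by
    rw [← hGp (a + 1) (by linarith)]; exact (hdet _).isUnit
  have hTmu : IsUnit Tm.det := by
    rw [← hGm (-a - 1) (by linarith)]; exact (hdet _).isUnit
  have hGi : Continuous fun x => (G x)⁻¹ := by
    have : (fun x => (G x)⁻¹) = fun x => ((G x).det)⁻¹ • (G x).adjugate := by
      funext x
      rw [Matrix.inv_def, Ring.inverse_eq_inv']
    rw [this]
    exact (hG.matrix_det.inv₀ hdet).smul hG.matrix_adjugate
  obtain ⟨B₁, hB₁⟩ := exists_norm_bound_of_eventually_const hG hGp hGm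
  obtain ⟨B₂, hB₂⟩ := exists_norm_bound_of_eventually_const hGi
    (fun x hx => by rw [hGp x hx]) (fun x hx => by rw [hGm x hx])
  have hB₁0 : 0 ≤ B₁ := (norm_nonneg _).trans (hB₁ 0)
  have hB₂0 : 0 ≤ B₂ := (norm_nonneg _).trans (hB₂ 0)
  obtain ⟨B, hB0, hB⟩ : ∃ B : ℝ, 0 ≤ B ∧ ∀ x y j k,
      ‖(G x * coordProj s * (G y)⁻¹) j k‖ ≤ B := by
    refine ⟨∑ _l : ι, B₁ * B₂, by positivity, fun x y j k => ?_⟩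
    rw [Matrix.mul_apply]
    refine norm_sum_le_of_le _ fun l _ => ?_
    rw [norm_mul]
    refine mul_le_mul ?_ ((Matrix.norm_entry_le_entrywise_sup_norm _).trans (hB₂ y))
      (norm_nonneg _) hB₁0
    rw [mul_coordProj_apply]
    split_ifs
    · exact (Matrix.norm_entry_le_entrywise_sup_norm _).trans (hB₁ x)
    · simpa using hB₁0
  set K : ℝ := ∑ j, |κ j|
  have hκ : ∀ j, |κ j| ≤ K := fun j =>
    Finset.single_le_sum (f := fun j => |κ j|) (fun i _ => abs_nonneg _) (Finset.mem_univ j)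
  have hK0 : 0 ≤ K := Finset.sum_nonneg fun i _ => abs_nonneg _
  set D : ℝ := 2 * (K + ρ) * a with hD
  have hD0 : 0 ≤ D := by positivity
  have habs : ∀ j, |κ j - ρ| * a ≤ (K + ρ) * a := fun j => by
    refine mul_le_mul_of_nonneg_right ?_ ha.le
    calc |κ j - ρ| ≤ |κ j| + |ρ| := abs_sub _ _
      _ ≤ K + ρ := by rw [abs_of_nonneg hρ]; linarith [hκ j]
  have hsx : ∀ j x, s j → x ≤ a → (κ j - ρ) * x ≤ (K + ρ) * a := fun j x hj hx => by
    refine le_trans ?_ (habs j)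
    rw [abs_of_nonneg (by linarith [hs j hj])]
    exact mul_le_mul_of_nonneg_left hx (by linarith [hs j hj])
  have hnx : ∀ j x, ¬ s j → -a ≤ x → (κ j - ρ) * x ≤ (K + ρ) * a := fun j x hj hx => by
    refine le_trans ?_ (habs j)
    rw [abs_of_nonpos (by linarith [hns j hj])]
    nlinarith [hns j hj]
  refine ⟨(B + 1) * Real.exp D, by positivity, fun x y hxy j k => ?_⟩
  -- It suffices to bound the exponent whenever the matrix entry is nonzero and uncancelled.
  have key : (κ j - ρ) * x + (κ k - ρ) * (-y) ≤ D →
      Real.exp (κ j * x - κ k * y) * ‖(G x * coordProj s * (G y)⁻¹) j k‖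
        ≤ (B + 1) * Real.exp D * Real.exp (-ρ * (y - x)) := fun h => by
    calc _ ≤ Real.exp (D + -ρ * (y - x)) * (B + 1) := by
          refine mul_le_mul (Real.exp_le_exp.2 (by linarith)) ((hB x y j k).trans (by linarith))
            (norm_nonneg _) (Real.exp_pos _).le
      _ = _ := by rw [Real.exp_add]; ring
  have zero : (G x * coordProj s * (G y)⁻¹) j k = 0 →
      Real.exp (κ j * x - κ k * y) * ‖(G x * coordProj s * (G y)⁻¹) j k‖
        ≤ (B + 1) * Real.exp D * Real.exp (-ρ * (y - x)) := fun h => by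
    rw [h, norm_zero, mul_zero]; positivity
  have one : s j → (G x * coordProj s * (G y)⁻¹) j k = (1 : Matrix ι ι ℂ) j k →
      Real.exp (κ j * x - κ k * y) * ‖(G x * coordProj s * (G y)⁻¹) j k‖
        ≤ (B + 1) * Real.exp D * Real.exp (-ρ * (y - x)) := fun hj h => by
    by_cases hjk : j = k
    · subst hjk
      apply key
      nlinarith [hs j hj]
    · exact zero (by rw [h, Matrix.one_apply_ne hjk])
  have col : a < y → ¬ s k → (G x * coordProj s * (G y)⁻¹) j k = 0 := fun hy hk => by
    rw [hGp y hy, Matrix.mul_apply]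
    refine Finset.sum_eq_zero fun l _ => ?_
    rw [inv_apply_of_col (s := fun j => ¬ s j) hTpu hTp hk, mul_coordProj_apply]
    by_cases hlk : l = k
    · subst hlk; simp [hk]
    · simp [Matrix.one_apply_ne hlk]
  have row : x < -a → ¬ s j → (G x * coordProj s * (G y)⁻¹) j k = 0 := fun hx hj => by
    rw [hGm x hx, mul_coordProj_eq hTm, coordProj_mul_apply, if_neg hj]
  by_cases hj : s j
  · by_cases hk : s k
    · by_cases hx : a < x
      · apply one hj
        have hy : a < y := hx.trans_le hxy
        have hsum : coordProj s = 1 - coordProj (fun j => ¬ s j) :=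
          eq_sub_of_add_eq coordProj_add_not
        rw [hGp x hx, hGp y hy, hsum, Matrix.mul_sub, mul_one, Matrix.sub_mul,
          Matrix.mul_nonsing_inv _ hTpu, mul_coordProj_eq (s := fun j => ¬ s j) hTp,
          Matrix.sub_apply, coordProj_mul_apply]
        simp [hj]
      · by_cases hy : y < -a
        · apply one hj
          have hx' : x < -a := hxy.trans_lt hy
          rw [hGm x hx', hGm y hy, mul_coordProj_eq hTm, coordProj_mul_apply, if_pos hj,
            inv_apply_of_col hTmu hTm hk]
        · apply key
          linarith [hsx j x hj (not_lt.1 hx), hsx k (-y) hk (by linarith [not_lt.1 hy])]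
    · by_cases hy : a < y
      · exact zero (col hy hk)
      · apply key
        have hy := not_lt.1 hy
        linarith [hsx j x hj (hxy.trans hy), hnx k (-y) hk (by linarith)]
  · by_cases hx : x < -a
    · exact zero (row hx hj)
    have hx := not_lt.1 hx
    by_cases hk : s k
    · apply key
      linarith [hnx j x hj hx, hsx k (-y) hk (by linarith)]
    · by_cases hy : a < y
      · exact zero (col hy hk)
      · apply key
        linarith [hnx j x hj hx, hnx k (-y) hk (by linarith [not_lt.1 hy])]

end coordProj

/-- Conjugating by fixed matrices preserves entrywise bounds up to a constant. -/
lemma exists_norm_mul_mul_le {ι : Type*} [Fintype ι] (A B : Matrix ι ι ℂ) :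
    ∃ C : ℝ, 0 ≤ C ∧ ∀ (M : Matrix ι ι ℂ) (r : ℝ), 0 ≤ r → (∀ j k, ‖M j k‖ ≤ r) →
      ‖A * M * B‖ ≤ C * r := by
  refine ⟨∑ _k : ι, ∑ _j : ι, ‖A‖ * ‖B‖, by positivity, fun M r hr hM => ?_⟩
  rw [Matrix.norm_le_iff (by positivity)]
  intro i l
  rw [Matrix.mul_apply, Finset.sum_mul]
  refine norm_sum_le_of_le _ fun k _ => ?_
  rw [Matrix.mul_apply, Finset.sum_mul, Finset.sum_mul]
  refine norm_sum_le_of_le _ fun j _ => ?_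
  rw [norm_mul, norm_mul]
  calc ‖A i j‖ * ‖M j k‖ * ‖B k l‖ ≤ ‖A‖ * r * ‖B‖ := by
        gcongr
        · exact Matrix.norm_entry_le_entrywise_sup_norm _
        · exact hM j k
        · exact Matrix.norm_entry_le_entrywise_sup_norm _
    _ = ‖A‖ * ‖B‖ * r := by ring

/-- On an open interval where the potential vanishes, a solution is differentiable. -/
lemma IsSolV.hasDerivAt {N : ℕ} {L₀ : Matrix (Fin N) (Fin N) ℂ}
    {V : ℝ → Matrix (Fin N) (Fin N) ℂ} {u : ℝ → Fin N → ℂ}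
    (hu : IsSolV N (fun x => L₀ + V x) u) {S : Set ℝ} (hS : IsOpen S) (hSc : S.OrdConnected)
    (hV : ∀ x ∈ S, V x = 0) {x : ℝ} (hx : x ∈ S) : HasDerivAt u (L₀.mulVec (u x)) x := by
  have hc : Continuous fun y => L₀.mulVec (u y) := continuous_const.matrix_mulVec hu.1
  have h1 : HasDerivAt (fun t => u x + ∫ y in x..t, L₀.mulVec (u y)) (L₀.mulVec (u x)) x :=
    (intervalIntegral.integral_hasDerivAt_right (hc.intervalIntegrable _ _)
      hc.stronglyMeasurable.stronglyMeasurableAtFilter hc.continuousAt).const_add _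
  refine h1.congr_of_eventuallyEq ?_
  filter_upwards [hS.mem_nhds hx] with t ht
  rw [hu.2 x t]
  congr 1
  refine intervalIntegral.integral_congr fun y hy => ?_
  simp [hV y (hSc.uIcc_subset hx ht hy)]

/-- On an interval without potential, the exponential coordinates of a solution are constant. -/
lemma IsSolV.exp_coord_const {N : ℕ} {L₀ : Matrix (Fin N) (Fin N) ℂ}
    {V : ℝ → Matrix (Fin N) (Fin N) ℂ} {u : ℝ → Fin N → ℂ}
    (hu : IsSolV N (fun x => L₀ + V x) u) {S : Set ℝ} (hS : IsOpen S) (hSc : S.OrdConnected)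
    (hV : ∀ x ∈ S, V x = 0) {W : Matrix (Fin N) (Fin N) ℂ} {ζ : Fin N → ℂ}
    (hW : W * L₀ = Matrix.diagonal ζ * W) (k : Fin N) {x y : ℝ} (hx : x ∈ S) (hy : y ∈ S) :
    Complex.exp (-(ζ k * x)) * W.mulVec (u x) k = Complex.exp (-(ζ k * y)) * W.mulVec (u y) k := by
  have hd : ∀ t ∈ S, HasDerivAt
      (fun t : ℝ => Complex.exp (-(ζ k * t)) * W.mulVec (u t) k) 0 t := by
    intro t ht
    have hexp : HasDerivAt (fun t : ℝ => Complex.exp (-(ζ k * t)))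
        (Complex.exp (-(ζ k * t)) * -(ζ k * 1)) t :=
      (((hasDerivAt_id t).ofReal_comp.const_mul (ζ k)).neg).cexp
    have hlin : HasDerivAt (fun t : ℝ => W.mulVec (u t) k)
        (W.mulVec (L₀.mulVec (u t)) k) t := by
      have hcoord := hasDerivAt_pi.1 (hu.hasDerivAt hS hSc hV ht)
      simp only [Matrix.mulVec, dotProduct] at hcoord ⊢
      exact HasDerivAt.fun_sum fun i _ => (hcoord i).const_mul _
    have hz : W.mulVec (L₀.mulVec (u t)) k = ζ k * W.mulVec (u t) k := by
      rw [Matrix.mulVec_mulVec, hW, ← Matrix.mulVec_mulVec, Matrix.mulVec_diagonal]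
    refine (hexp.mul hlin).congr_deriv ?_
    rw [hz]; ring
  exact hS.is_const_of_deriv_eq_zero hSc.isPreconnected
    (fun t ht => (hd t ht).differentiableAt.differentiableWithinAt) (fun t ht => (hd t ht).deriv)
    hx hy

/-- The matrix whose columns are eigenvectors for distinct eigenvalues is invertible. -/
lemma isUnit_det_of_eigenvectors {N : ℕ} {L₀ : Matrix (Fin N) (Fin N) ℂ} {ζ : Fin N → ℂ}
    {p : Fin N → Fin N → ℂ} (hdist : Function.Injective ζ)
    (heig : ∀ j, L₀.mulVec (p j) = ζ j • p j) (hp0 : ∀ j, p j ≠ 0) :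
    IsUnit (Matrix.of fun k j => p j k).det := by
  have hli : LinearIndependent ℂ p :=
    Module.End.eigenvectors_linearIndependent' (Matrix.toLin' L₀) ζ hdist p fun j =>
      ⟨Module.End.mem_eigenspace_iff.2 (by rw [Matrix.toLin'_apply, heig]), hp0 j⟩
  rw [← Matrix.isUnit_iff_isUnit_det, ← Matrix.linearIndependent_cols_iff_isUnit]
  exact hli

/-- the resolvent kernel `R(x,y) = −U(x) P₊ U(y)⁻¹` for `x ≤ y` and
`R(x,y) = U(x) P₋ U(y)⁻¹` for `x > y` satisfies `‖R(x,y)‖ ≤ C e^{−ρ|x−y|}` with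
`ρ = min(ρ₊, ρ₋)`. -/
theorem statement_7 (N n : ℕ) (hN : 1 ≤ N) (hn : n ≤ N)
    (L₀ : Matrix (Fin N) (Fin N) ℂ) (ζ : Fin N → ℂ) (p : Fin N → Fin N → ℂ)
    (hdist : Function.Injective ζ)
    (heig : ∀ j, L₀.mulVec (p j) = ζ j • p j) (hp0 : ∀ j, p j ≠ 0)
    (hre : ∀ j, (ζ j).re ≠ 0)
    (hpos : ∀ j : Fin N, (j : ℕ) < n → 0 < (ζ j).re)
    (hneg : ∀ j : Fin N, n ≤ (j : ℕ) → (ζ j).re < 0)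
    (a : ℝ) (ha : 0 < a)
    (V : ℝ → Matrix (Fin N) (Fin N) ℂ)
    (hVloc : ∀ i j : Fin N, MeasureTheory.LocallyIntegrable fun x : ℝ => V x i j)
    (hVsupp : ∀ x : ℝ, x ∉ Set.Icc (-a) a → V x = 0)
    (u : Fin N → ℝ → Fin N → ℂ)
    (husol : ∀ j, IsSolV N (fun x => L₀ + V x) (u j))
    (hbcm : ∀ j : Fin N, (j : ℕ) < n → ∀ x : ℝ, x < -a → u j x = Complex.exp (ζ j * x) • p j)
    (hbcp : ∀ j : Fin N, n ≤ (j : ℕ) → ∀ x : ℝ, x > a → u j x = Complex.exp (ζ j * x) • p j)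
    (U : ℝ → Matrix (Fin N) (Fin N) ℂ)
    (hU : ∀ x, U x = Matrix.of fun k j => u j x k)
    (hdet : ∀ x, (U x).det ≠ 0)
    (ρp ρm ρ : ℝ)
    (hρp : IsLeast ((fun j => (ζ j).re) '' {j : Fin N | (j : ℕ) < n}) ρp)
    (hρm : IsLeast ((fun j => |(ζ j).re|) '' {j : Fin N | n ≤ (j : ℕ)}) ρm)
    (hρ : ρ = min ρp ρm)
    (Pp Pm : Matrix (Fin N) (Fin N) ℂ)
    (hPp : Pp = Matrix.diagonal fun j : Fin N => if (j : ℕ) < n then 1 else 0)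
    (hPm : Pm = Matrix.diagonal fun j : Fin N => if (j : ℕ) < n then 0 else 1)
    (R : ℝ → ℝ → Matrix (Fin N) (Fin N) ℂ)
    (hR : ∀ x y : ℝ, R x y =
      if x ≤ y then -(U x * Pp * (U y)⁻¹) else U x * Pm * (U y)⁻¹) :
    ∃ C : ℝ, ∀ x y : ℝ, ‖R x y‖ ≤ C * Real.exp (-ρ * |x - y|) := by
  let s : Fin N → Prop := fun j => (j : ℕ) < n
  set Q : Matrix (Fin N) (Fin N) ℂ := Matrix.of fun k j => p j k
  have hQu : IsUnit Q.det := isUnit_det_of_eigenvectors hdist heig hp0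
  have hLQ : L₀ * Q = Q * Matrix.diagonal ζ := by
    ext k j
    rw [Matrix.mul_diagonal]
    simpa [Matrix.mulVec, dotProduct, Matrix.mul_apply, Q, mul_comm] using congrFun (heig j) k
  have hW : Q⁻¹ * L₀ = Matrix.diagonal ζ * Q⁻¹ := by
    calc Q⁻¹ * L₀ = Q⁻¹ * (L₀ * Q) * Q⁻¹ := by
          rw [Matrix.mul_assoc, Matrix.mul_assoc, Matrix.mul_nonsing_inv _ hQu, mul_one]
      _ = _ := by rw [hLQ, ← Matrix.mul_assoc, Matrix.nonsing_inv_mul _ hQu, one_mul]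
  obtain ⟨E, hE⟩ : ∃ E : ℝ → Matrix (Fin N) (Fin N) ℂ,
      ∀ x, E x = Matrix.diagonal fun j => Complex.exp (ζ j * x) := ⟨_, fun _ => rfl⟩
  obtain ⟨F, hF⟩ : ∃ F : ℝ → Matrix (Fin N) (Fin N) ℂ,
      ∀ x, F x = Matrix.diagonal fun j => Complex.exp (-(ζ j * x)) := ⟨_, fun _ => rfl⟩
  have hEF : ∀ x, E x * F x = 1 := fun x => by
    simp [hE, hF, Matrix.diagonal_mul_diagonal, ← Complex.exp_add]
  obtain ⟨G, hG⟩ : ∃ G : ℝ → Matrix (Fin N) (Fin N) ℂ,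
      ∀ x, G x = F x * (Q⁻¹ * U x) := ⟨_, fun _ => rfl⟩
  have hGapp : ∀ x k j, G x k j = Complex.exp (-(ζ k * x)) * Q⁻¹.mulVec (u j x) k := by
    intro x k j
    rw [hG, hF, Matrix.diagonal_mul, hU]
    rfl
  have hUG : ∀ x, U x = Q * E x * G x := fun x => by
    rw [hG, Matrix.mul_assoc, ← Matrix.mul_assoc (E x), hEF, one_mul, ← Matrix.mul_assoc,
      Matrix.mul_nonsing_inv _ hQu, one_mul]
  have hGdet : ∀ x, (G x).det ≠ 0 := fun x h => by
    apply hdet x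
    rw [hUG x, Matrix.det_mul, h, mul_zero]
  have hEinv : ∀ x, (E x)⁻¹ = F x := fun x => Matrix.inv_eq_right_inv (hEF x)
  have hUinv : ∀ x, (U x)⁻¹ = (G x)⁻¹ * (F x * Q⁻¹) := fun x => by
    rw [hUG x, Matrix.mul_inv_rev, Matrix.mul_inv_rev, hEinv]
  have hconj : ∀ x y P, U x * P * (U y)⁻¹ = Q * (E x * (G x * P * (G y)⁻¹) * F y) * Q⁻¹ := by
    intro x y P
    rw [hUinv, hUG x]
    simp only [Matrix.mul_assoc]
  have hGc : Continuous G := by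
    refine continuous_matrix fun k j => ?_
    have huc := (husol j).1
    have hm : Continuous fun x => Q⁻¹.mulVec (u j x) := continuous_const.matrix_mulVec huc
    have hmk : Continuous fun x => Q⁻¹.mulVec (u j x) k := (continuous_apply k).comp hm
    simp only [hGapp]
    fun_prop
  have hconst : ∀ S : Set ℝ, IsOpen S → S.OrdConnected → (∀ x ∈ S, x ∉ Set.Icc (-a) a) →
      ∀ x ∈ S, ∀ y ∈ S, G x = G y := by
    intro S hS hSc hSV x hx y hy
    ext k j
    rw [hGapp, hGapp]
    exact (husol j).exp_coord_const hS hSc (fun t ht => hVsupp t (hSV t ht)) hW k hx hy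
  have hGp : ∀ x, a < x → G x = G (a + 1) := fun x hx =>
    hconst (Set.Ioi a) isOpen_Ioi Set.ordConnected_Ioi
      (fun t ht h => absurd h.2 (not_le.2 ht)) x hx _ (by simp)
  have hGm : ∀ x, x < -a → G x = G (-a - 1) := fun x hx =>
    hconst (Set.Iio (-a)) isOpen_Iio Set.ordConnected_Iio
      (fun t ht h => absurd h.1 (not_le.2 ht)) x hx _ (by simp)
  have hQp : ∀ k j, Q⁻¹.mulVec (p j) k = (1 : Matrix (Fin N) (Fin N) ℂ) k j := fun k j => by
    rw [← Matrix.nonsing_inv_mul _ hQu, Matrix.mul_apply]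
    rfl
  have hcol : ∀ x k j, u j x = Complex.exp (ζ j * x) • p j →
      G x k j = (1 : Matrix (Fin N) (Fin N) ℂ) k j := by
    intro x k j h
    rw [hGapp, h, Matrix.mulVec_smul, Pi.smul_apply, hQp, smul_eq_mul]
    by_cases hkj : k = j
    · subst hkj
      rw [Matrix.one_apply_eq, mul_one, ← Complex.exp_add]
      simp
    · simp [Matrix.one_apply_ne hkj]
  have hTp : ∀ k j, ¬ s j → G (a + 1) k j = (1 : Matrix (Fin N) (Fin N) ℂ) k j := fun k j hj =>
    hcol _ k j (hbcp j (not_lt.1 hj) _ (by linarith))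
  have hTm : ∀ k j, s j → G (-a - 1) k j = (1 : Matrix (Fin N) (Fin N) ℂ) k j := fun k j hj =>
    hcol _ k j (hbcm j hj _ (by linarith))
  have hκp : ∀ j, s j → ρ ≤ (ζ j).re := fun j hj =>
    (hρ ▸ min_le_left _ _).trans (hρp.2 ⟨j, hj, rfl⟩)
  have hκm : ∀ j, ¬ s j → (ζ j).re ≤ -ρ := fun j hj => by
    have h1 : ρ ≤ |(ζ j).re| := (hρ ▸ min_le_right _ _).trans (hρm.2 ⟨j, not_lt.1 hj, rfl⟩)
    rw [abs_of_neg (hneg j (not_lt.1 hj))] at h1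
    linarith
  have hρ0 : 0 ≤ ρ := by
    obtain ⟨i, hi, rfl⟩ := hρp.1
    obtain ⟨j, -, rfl⟩ := hρm.1
    rw [hρ]
    exact le_min (hpos i hi).le (abs_nonneg _)
  obtain ⟨C₁, hC₁0, hC₁⟩ := exists_bound_dichotomy (s := s) hρ0 ha hκp hκm hGc hGdet hGp hGm
    hTp hTm
  -- The case `y < x` is the case `x ≤ y` reflected through the origin.
  obtain ⟨C₂, hC₂0, hC₂⟩ := exists_bound_dichotomy (s := fun j => ¬ s j)
    (κ := fun j => -(ζ j).re) hρ0 ha (fun j hj => by linarith [hκm j hj])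
    (fun j hj => by linarith [hκp j (not_not.1 hj)]) (hGc.comp continuous_neg)
    (fun x => hGdet (-x)) (fun x hx => hGm (-x) (by linarith))
    (fun x hx => hGp (-x) (by linarith)) (fun k j hj => hTm k j (not_not.1 hj)) hTp
  obtain ⟨C₀, hC₀0, hC₀⟩ := exists_norm_mul_mul_le Q Q⁻¹
  have hentry : ∀ x y (M : Matrix (Fin N) (Fin N) ℂ) j k, ‖(E x * M * F y) j k‖ =
      Real.exp ((ζ j).re * x - (ζ k).re * y) * ‖M j k‖ := by
    intro x y M j k
    simp only [hE, hF, Matrix.mul_diagonal, Matrix.diagonal_mul, norm_mul, Complex.norm_exp]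
    rw [sub_eq_add_neg, Real.exp_add]
    simp
    ring
  have hPm' : Pm = coordProj fun j => ¬ s j := by
    rw [hPm, coordProj]
    congr 1
    funext j
    by_cases hj : (j : ℕ) < n <;> simp [s, hj]
  have hPp' : Pp = coordProj s := hPp
  refine ⟨C₀ * (C₁ + C₂), fun x y => ?_⟩
  rw [hR]
  split_ifs with hxy
  · rw [norm_neg, hconj, mul_assoc C₀, abs_of_nonpos (by linarith)]
    refine hC₀ _ _ (by positivity) fun j k => ?_
    rw [hentry, hPp', neg_sub]
    refine (hC₁ x y hxy j k).trans ?_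
    gcongr
    linarith
  · have hxy := not_le.1 hxy
    rw [hconj, mul_assoc C₀, abs_of_nonneg (by linarith)]
    refine hC₀ _ _ (by positivity) fun j k => ?_
    rw [hentry, hPm']
    have h2 := hC₂ (-x) (-y) (by linarith) j k
    simp only [Function.comp_apply, neg_neg, neg_mul_neg] at h2
    rw [show -y - -x = x - y by ring] at h2
    refine h2.trans ?_
    gcongr
    linarith
end
end

section
/- Let u_j⁰(x,z) = e^{ζ_j x}, let U₀(x,z) be the Wronskian matrix with (k,j) entry ζ_j^{k−1} e^{ζ_j x}, W₀(x,z) = det U₀(x,z), G⁰(x,z) = U₀(x,z)⁻¹ with entries g⁰_{j,l}, and let the free resolvent kernel be R₀(x,y,z) = −i^N Σ_{j=1}^{n} e^{ζ_j x} g⁰_{j,N}(y,z) for x < y and R₀(x,y,z) = i^N Σ_{j=n+1}^{N} e^{ζ_j x} g⁰_{j,N}(y,z) for x ≥ y. Set W(x,z) = det U(x,z) and Δ(x,z) = W(x,z)/W₀(x,z). Assume there is an open neighborhood Ω of z carrying differentiable root selections ζ_j(z') (with the sign convention Re ζ_j > 0 for j ≤ n, Re ζ_j < 0 for j > n) and solutions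 u_j(·,z') satisfying the same boundary conditions, such that every entry of U(x,z') is differentiable in z'. Then for every x ∈ ℝ the limit lim_{x₁→−∞, x₂→+∞} ∫_{x₁}^{x₂} ( R(y,y,z) − R₀(y,y,z) ) dy exists and equals −Δ(x,z)⁻¹ · ∂Δ(x,z)/∂z. -/
open MeasureTheory Filter Topology

noncomputable section

/-- A solution of the scalar equation `i^{-N} u^{(N)} + v_N u^{(N-1)} + ⋯ + v₁ u = z u`:
a `C^{N-1}` function whose `(N-1)`-st derivative is locally absolutely continuous (with density
`g`) and which satisfies the equation almost everywhere. -/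
def IsScalarSol (N : ℕ) (v : Fin N → ℝ → ℂ) (z : ℂ) (u : ℝ → ℂ) : Prop :=
  ContDiff ℝ (N - 1 : ℕ) u ∧ ∃ g : ℝ → ℂ,
    (∀ x₀ x : ℝ, iteratedDeriv (N - 1) u x = iteratedDeriv (N - 1) u x₀ + ∫ y in x₀..x, g y) ∧
    ∀ᵐ x : ℝ, Complex.I ^ (-(N : ℤ)) * g x + (∑ k : Fin N, v k x * iteratedDeriv k u x) = z * u x

/-- If `U` solves `U' = A U` and `V` solves `V' = A V + F` in the integrated sense and `P` is the
pointwise inverse of `U`, then `P V` is differentiable wherever `F` is continuous. -/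
lemma hasDerivAt_mul_of_integral_eq {𝔸 : Type*} [NormedRing 𝔸] [NormedAlgebra ℝ 𝔸]
    [CompleteSpace 𝔸] {A F U V P : ℝ → 𝔸}
    (hA : ∀ s t, IntervalIntegrable A volume s t) (hF : ∀ s t, IntervalIntegrable F volume s t)
    (hUc : Continuous U) (hVc : Continuous V) (hPc : Continuous P)
    (hPU : ∀ x, P x * U x = 1) (hUP : ∀ x, U x * P x = 1) (x₀ : ℝ)
    (hU : ∀ x, U x - U x₀ = ∫ y in x₀..x, A y * U y)
    (hV : ∀ x, V x - V x₀ = ∫ y in x₀..x, (A y * V y + F y))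
    (hFc : ContinuousAt F x₀) :
    HasDerivAt (fun x => P x * V x) (P x₀ * F x₀) x₀ := by
  set m : ℝ → 𝔸 := fun x => P x * V x - P x₀ * V x₀ with hm
  have hmc : Continuous m := (hPc.mul hVc).sub continuous_const
  have hAU : ∀ s t, IntervalIntegrable (fun y => A y * U y) volume s t := fun s t =>
    (hA s t).mul_continuousOn hUc.continuousOn
  have hAUm : ∀ s t, IntervalIntegrable (fun y => A y * U y * m y) volume s t := fun s t =>
    (hAU s t).mul_continuousOn hmc.continuousOn
  set J : ℝ → 𝔸 := fun x => ∫ y in x₀..x, A y * U y * m y with hJ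
  set I : ℝ → 𝔸 := fun x => ∫ y in x₀..x, F y with hI
  have key : ∀ x, m x = P x * J x + P x * I x := by
    intro x
    have h1 : U x * m x = J x + I x := by
      have e1 : U x * m x = (V x - V x₀) - (U x - U x₀) * (P x₀ * V x₀) := by
        have a1 : U x * (P x * V x) = V x := by rw [← mul_assoc, hUP, one_mul]
        have a2 : U x₀ * (P x₀ * V x₀) = V x₀ := by rw [← mul_assoc, hUP, one_mul]
        simp only [hm, mul_sub, sub_mul, a1, a2]; abel
      have e2 : (∫ y in x₀..x, A y * U y) * (P x₀ * V x₀)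
          = ∫ y in x₀..x, A y * U y * (P x₀ * V x₀) := by
        have := ContinuousLinearMap.intervalIntegral_comp_comm
          ((ContinuousLinearMap.mul ℝ 𝔸).flip (P x₀ * V x₀)) (hAU x₀ x)
        simpa using this.symm
      rw [e1, hV x, hU x, e2, ← intervalIntegral.integral_sub, hJ, hI]
      · simp only
        rw [← intervalIntegral.integral_add (hAUm _ _) (hF _ _)]
        refine intervalIntegral.integral_congr fun y _ => ?_
        have a1 : A y * U y * (P y * V y) = A y * V y := by
          rw [mul_assoc, ← mul_assoc (U y), hUP, one_mul]
        simp only [hm, mul_sub, a1]; abel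
      · exact ((hA _ _).mul_continuousOn hVc.continuousOn).add (hF _ _)
      · exact (hAU _ _).mul_continuousOn continuousOn_const
    rw [← mul_add, ← h1, ← mul_assoc, hPU, one_mul]
  have hI' : HasDerivAt I (F x₀) x₀ :=
    intervalIntegral.integral_hasDerivAt_right (hF _ _)
      ⟨Set.Ioc (x₀ - 1) (x₀ + 1), Ioc_mem_nhds (by linarith) (by linarith),
        (hF (x₀ - 1) (x₀ + 1)).aestronglyMeasurable⟩ hFc
  have hI0 : I x₀ = 0 := by simp [hI]
  set φ : ℝ → ℝ := fun x => |∫ y in x₀..x, ‖A y * U y‖| with hφ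
  have hφc : Continuous φ :=
    (intervalIntegral.continuous_primitive (fun s t => (hAU s t).norm) x₀).abs
  have hφ0 : φ x₀ = 0 := by simp [hφ]
  have hJb : ∀ x S, (∀ y ∈ Set.uIcc x₀ x, ‖m y‖ ≤ S) → ‖J x‖ ≤ φ x * S := by
    intro x S hS
    have hS0 : 0 ≤ S := (norm_nonneg _).trans (hS x₀ Set.left_mem_uIcc)
    refine (intervalIntegral.norm_integral_le_abs_of_norm_le (g := fun y => ‖A y * U y‖ * S)
      ?_ ((hAU _ _).norm.mul_const S)).trans ?_
    · refine (ae_restrict_iff' measurableSet_uIoc).2 (ae_of_all _ fun y hy => ?_)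
      exact (norm_mul_le _ _).trans
        (mul_le_mul_of_nonneg_left (hS y (Set.uIoc_subset_uIcc hy)) (norm_nonneg _))
    · rw [intervalIntegral.integral_mul_const, abs_mul, abs_of_nonneg hS0]
  obtain ⟨K, hK⟩ := hI'.isBigO_sub.bound
  have hPb : ∀ᶠ x in 𝓝 x₀, ‖P x‖ < ‖P x₀‖ + 1 :=
    hPc.norm.continuousAt.eventually (gt_mem_nhds (by linarith))
  have hsmall : ∀ᶠ x in 𝓝 x₀, ‖P x‖ * φ x < 1 / 2 := by
    have : ContinuousAt (fun x => ‖P x‖ * φ x) x₀ := (hPc.norm.mul hφc).continuousAt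
    exact this.eventually (gt_mem_nhds (by simp [hφ0]))
  obtain ⟨δ, hδ, hball⟩ := Metric.eventually_nhds_iff_ball.1 ((hK.and hPb).and hsmall)
  set C := (‖P x₀‖ + 1) * |K| with hC
  have hC0 : 0 ≤ C := by positivity
  have hmb : ∀ x ∈ Metric.ball x₀ δ, ∀ y ∈ Set.uIcc x₀ x, ‖m y‖ ≤ 2 * C * |x - x₀| := by
    intro x hx
    obtain ⟨w, hw, hmax⟩ := isCompact_uIcc.exists_isMaxOn (⟨x₀, Set.left_mem_uIcc⟩ :
      (Set.uIcc x₀ x).Nonempty) hmc.norm.continuousOn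
    have hwx : |w - x₀| ≤ |x - x₀| := Set.abs_sub_left_of_mem_uIcc hw
    have hwb : w ∈ Metric.ball x₀ δ := by
      rw [Metric.mem_ball, Real.dist_eq] at hx ⊢
      exact hwx.trans_lt hx
    obtain ⟨⟨h1, h2⟩, h3⟩ := hball w hwb
    have h4 : ‖J w‖ ≤ φ w * ‖m w‖ := hJb w _ fun y hy =>
      hmax (Set.uIcc_subset_uIcc Set.left_mem_uIcc hw hy)
    have h5 : ‖m w‖ ≤ ‖P w‖ * ‖J w‖ + ‖P w‖ * ‖I w‖ := by
      conv_lhs => rw [key w]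
      exact (norm_add_le _ _).trans (add_le_add (norm_mul_le _ _) (norm_mul_le _ _))
    have h6 : ‖P w‖ * ‖J w‖ ≤ 1 / 2 * ‖m w‖ := by
      calc ‖P w‖ * ‖J w‖ ≤ ‖P w‖ * (φ w * ‖m w‖) := by gcongr
        _ = (‖P w‖ * φ w) * ‖m w‖ := by ring
        _ ≤ 1 / 2 * ‖m w‖ := by gcongr
    have h7 : ‖P w‖ * ‖I w‖ ≤ C * |x - x₀| := by
      have : ‖I w‖ ≤ |K| * |x - x₀| := by
        rw [hI0, sub_zero, Real.norm_eq_abs] at h1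
        refine h1.trans ?_
        gcongr
        exact le_abs_self K
      calc ‖P w‖ * ‖I w‖ ≤ (‖P x₀‖ + 1) * (|K| * |x - x₀|) := by gcongr
        _ = C * |x - x₀| := by rw [hC]; ring
    intro y hy
    have h8 : ‖m y‖ ≤ ‖m w‖ := hmax hy
    linarith
  have hJ' : HasDerivAt J 0 x₀ := by
    rw [hasDerivAt_iff_isLittleO]
    have hJ0 : J x₀ = 0 := by simp [hJ]
    simp only [hJ0, sub_zero, smul_zero]
    rw [Asymptotics.isLittleO_iff]
    intro c hc
    have : ContinuousAt (fun x => φ x * (2 * C)) x₀ := (hφc.mul continuous_const).continuousAt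
    filter_upwards [this.eventually_lt_const (u := c) (by simpa [hφ0] using hc),
      Metric.ball_mem_nhds x₀ hδ] with x hx hxb
    calc ‖J x‖ ≤ φ x * (2 * C * |x - x₀|) := hJb x _ (hmb x hxb)
      _ = φ x * (2 * C) * |x - x₀| := by ring
      _ ≤ c * ‖x - x₀‖ := by rw [Real.norm_eq_abs]; gcongr
  have hG : HasDerivAt (fun x => J x + I x) (F x₀) x₀ := by
    simpa only [zero_add] using hJ'.fun_add hI'
  have hG0 : J x₀ + I x₀ = 0 := by simp [hJ, hI]
  have hmd : HasDerivAt m (P x₀ * F x₀) x₀ := by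
    rw [hasDerivAt_iff_tendsto_slope] at hG ⊢
    have hlim := (hPc.continuousAt.tendsto.mono_left nhdsWithin_le_nhds).mul hG
    refine hlim.congr fun x => ?_
    have hm0 : m x₀ = 0 := by simp [hm]
    rw [slope_def_module, slope_def_module, hG0, hm0, sub_zero, sub_zero, key x, ← mul_add,
      mul_smul_comm]
  have := hmd.add_const (P x₀ * V x₀)
  simpa [hm] using this

/-- The derivative in the parameter of a family of solutions of
`∂ₓ M = (z' - z) B M` with `M = 1` at `z' = z` is an antiderivative of `B`. -/
lemma hasDerivAt_deriv_param {𝔸 : Type*} [NormedRing 𝔸] [NormedAlgebra ℝ 𝔸]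
    [NormedAlgebra ℂ 𝔸] [SMulCommClass ℝ ℂ 𝔸] [CompleteSpace 𝔸] {B D : ℝ → 𝔸}
    {M : ℝ → ℂ → 𝔸} {z : ℂ} (hB : Continuous B)
    (hM : ∀ᶠ z' in 𝓝 z, ∀ x, HasDerivAt (fun t => M t z') ((z' - z) • (B x * M x z')) x)
    (hMz : ∀ x, M x z = 1) (hD : ∀ x, HasDerivAt (fun z' => M x z') (D x) z) (x : ℝ) :
    HasDerivAt D (B x) x := by
  have main : ∀ x₁ x₂, x₁ ≤ x₂ → D x₂ - D x₁ = ∫ y in x₁..x₂, B y := by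
    intro x₁ x₂ h12
    obtain ⟨K, hK⟩ := isCompact_Icc.exists_bound_of_continuousOn
      (hB.continuousOn (s := Set.Icc x₁ x₂))
    have hK0 : 0 ≤ K := (norm_nonneg _).trans (hK x₁ (Set.left_mem_Icc.2 h12))
    set S : ℝ := (‖(1 : 𝔸)‖ + 1) * Real.exp (K * (x₂ - x₁)) with hS
    have hbd : ∀ᶠ z' in 𝓝 z, ∀ y ∈ Set.Icc x₁ x₂, ‖M y z'‖ ≤ S := by
      have h1 : ∀ᶠ z' in 𝓝 z, ‖M x₁ z'‖ < ‖(1 : 𝔸)‖ + 1 :=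
        (hD x₁).continuousAt.norm.eventually (gt_mem_nhds (by simp only [hMz]; linarith))
      have h2 : ∀ᶠ z' in 𝓝 z, ‖z' - z‖ < 1 := by
        filter_upwards [Metric.ball_mem_nhds z one_pos] with z' hz'
        simpa [dist_eq_norm] using hz'
      filter_upwards [hM, h1, h2] with z' h0 h1 h2 y hy
      have hg := norm_le_gronwallBound_of_norm_deriv_right_le (f := fun t => M t z')
        (f' := fun x => (z' - z) • (B x * M x z')) (δ := ‖(1 : 𝔸)‖ + 1) (K := K) (ε := 0)
        (a := x₁) (b := x₂)
        (fun t _ => (h0 t).continuousAt.continuousWithinAt)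
        (fun t _ => (h0 t).hasDerivWithinAt) h1.le (fun t ht => by
          rw [norm_smul, add_zero]
          calc ‖z' - z‖ * ‖B t * M t z'‖ ≤ 1 * (‖B t‖ * ‖M t z'‖) := by
                gcongr
                exact norm_mul_le _ _
            _ ≤ K * ‖M t z'‖ := by
                rw [one_mul]
                gcongr
                exact hK t (Set.Ico_subset_Icc_self ht)) y hy
      refine hg.trans ?_
      rw [gronwallBound_ε0, hS]
      gcongr
      exact hy.2
    have hL : Tendsto (fun z' => ∫ y in x₁..x₂, B y * M y z') (𝓝[≠] z)
        (𝓝 (∫ y in x₁..x₂, B y)) := by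
      refine intervalIntegral.tendsto_integral_filter_of_dominated_convergence
        (fun _ => K * S) ?_ ?_ intervalIntegrable_const ?_
      · filter_upwards [nhdsWithin_le_nhds hM] with z' h0
        have : Continuous fun y => B y * M y z' :=
          hB.mul (continuous_iff_continuousAt.2 fun y => (h0 y).continuousAt)
        exact this.aestronglyMeasurable
      · filter_upwards [nhdsWithin_le_nhds hbd] with z' hz'
        refine ae_of_all _ fun y hy => ?_
        rw [Set.uIoc_of_le h12] at hy
        have hy' := Set.Ioc_subset_Icc_self hy
        exact (norm_mul_le _ _).trans
          (mul_le_mul (hK y hy') (hz' y hy') (norm_nonneg _) hK0)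
      · refine ae_of_all _ fun y _ => ?_
        have h := ((hD y).continuousAt.tendsto.mono_left
          (nhdsWithin_le_nhds (s := {z}ᶜ))).const_mul (B y)
        simpa [hMz] using h
    have hR := (hasDerivAt_iff_tendsto_slope.1 (hD x₂)).sub
      (hasDerivAt_iff_tendsto_slope.1 (hD x₁))
    refine tendsto_nhds_unique hR (hL.congr' ?_)
    filter_upwards [nhdsWithin_le_nhds hM, self_mem_nhdsWithin] with z' h0 hne
    have hne' : z' - z ≠ 0 := sub_ne_zero.2 hne
    have hMc : Continuous fun y => B y * M y z' :=
      hB.mul (continuous_iff_continuousAt.2 fun y => (h0 y).continuousAt)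
    have h := intervalIntegral.integral_eq_sub_of_hasDerivAt (a := x₁) (b := x₂)
      (fun y _ => h0 y) ((hMc.const_smul (z' - z)).intervalIntegrable _ _)
    rw [intervalIntegral.integral_smul] at h
    rw [slope_def_module, slope_def_module, hMz, hMz, ← smul_sub, sub_sub_sub_cancel_right, ← h,
      smul_smul, inv_mul_cancel₀ hne', one_smul]
  have h2 : ∀ t, D t = D x + ∫ y in x..t, B y := by
    intro t
    rcases le_total x t with h | h
    · rw [← main x t h]; abel
    · rw [intervalIntegral.integral_symm, ← main t x h]; abel
  rw [show D = fun t => D x + ∫ y in x..t, B y from funext h2]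
  exact ((intervalIntegral.integral_hasDerivAt_right (hB.intervalIntegrable _ _)
    (hB.stronglyMeasurableAtFilter _ _) hB.continuousAt).const_add _)

section MatrixSystem

attribute [local instance] Matrix.linftyOpNormedRing Matrix.linftyOpNormedAlgebra

/-- The topology of square matrices induced by the operator norm, which is the product topology. -/
@[reducible]
def matrixNormTopology (N : ℕ) : TopologicalSpace (Matrix (Fin N) (Fin N) ℂ) :=
  (Matrix.linftyOpNormedRing :
    NormedRing (Matrix (Fin N) (Fin N) ℂ)).toPseudoMetricSpace.toUniformSpace.toTopologicalSpace

attribute [local instance] matrixNormTopology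

lemma matrixNormTopology_eq (N : ℕ) : matrixNormTopology N = instTopologicalSpaceMatrix := rfl

open Complex in
/-- Coefficient matrix of the first order system equivalent to the scalar equation. -/
def companionMatrix {N : ℕ} (v : Fin N → ℝ → ℂ) (z : ℂ) (x : ℝ) : Matrix (Fin N) (Fin N) ℂ :=
  Matrix.of fun k l => if (k : ℕ) + 1 = N then I ^ N * ((if (l : ℕ) = 0 then z else 0) - v l x)
    else if (l : ℕ) = k + 1 then 1 else 0

open Complex in
/-- The derivative of `companionMatrix` with respect to the spectral parameter. -/
def companionParamDeriv (N : ℕ) : Matrix (Fin N) (Fin N) ℂ :=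
  Matrix.of fun k l => if (k : ℕ) + 1 = N then (if (l : ℕ) = 0 then I ^ N else 0) else 0

/-- The Wronskian matrix of a family of functions. -/
def wronskianMatrix {N : ℕ} (w : Fin N → ℝ → ℂ) (x : ℝ) : Matrix (Fin N) (Fin N) ℂ :=
  Matrix.of fun k j => iteratedDeriv k (w j) x

lemma companionMatrix_param {N : ℕ} (v : Fin N → ℝ → ℂ) (z z' : ℂ) (x : ℝ) :
    companionMatrix v z' x = companionMatrix v z x + (z' - z) • companionParamDeriv N := by
  ext k l
  simp only [companionMatrix, companionParamDeriv, Matrix.add_apply, Matrix.smul_apply,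
    Matrix.of_apply, smul_eq_mul]
  split_ifs <;> ring

lemma Matrix.intervalIntegrable_of_entries {N : ℕ} {F : ℝ → Matrix (Fin N) (Fin N) ℂ} {s t : ℝ}
    (h : ∀ i j, IntervalIntegrable (fun y => F y i j) volume s t) :
    IntervalIntegrable F volume s t := by
  have hF : F = fun y => ∑ i, ∑ j,
      (Matrix.singleLinearMap ℝ i j).toContinuousLinearMap (F y i j) := by
    funext y
    conv_lhs => rw [Matrix.matrix_eq_sum_single (F y)]
    rfl
  rw [hF]
  constructor
  · exact integrable_finsetSum _ fun i _ => integrable_finsetSum _ fun j _ =>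
      ContinuousLinearMap.integrable_comp _ (h i j).1
  · exact integrable_finsetSum _ fun i _ => integrable_finsetSum _ fun j _ =>
      ContinuousLinearMap.integrable_comp _ (h i j).2

lemma Matrix.intervalIntegral_apply {N : ℕ} {F : ℝ → Matrix (Fin N) (Fin N) ℂ} {s t : ℝ}
    (h : IntervalIntegrable F volume s t) (i j : Fin N) :
    (∫ y in s..t, F y) i j = ∫ y in s..t, F y i j :=
  (ContinuousLinearMap.intervalIntegral_comp_comm
    (Matrix.entryLinearMap ℝ ℂ i j).toContinuousLinearMap h).symm

lemma Matrix.hasDerivAt_of_entries {𝕜 : Type*} [RCLike 𝕜] [NormedAlgebra 𝕜 ℂ] {N : ℕ}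
    {F : 𝕜 → Matrix (Fin N) (Fin N) ℂ} {F' : Matrix (Fin N) (Fin N) ℂ} {x : 𝕜}
    (h : ∀ i j, HasDerivAt (fun y => F y i j) (F' i j) x) : HasDerivAt F F' x :=
  hasDerivAt_pi.2 fun i => hasDerivAt_pi.2 fun j => h i j

lemma Matrix.hasDerivAt_apply {𝕜 : Type*} [RCLike 𝕜] [NormedAlgebra 𝕜 ℂ] {N : ℕ}
    {F : 𝕜 → Matrix (Fin N) (Fin N) ℂ} {F' : Matrix (Fin N) (Fin N) ℂ} {x : 𝕜}
    (h : HasDerivAt F F' x) (i j : Fin N) : HasDerivAt (fun y => F y i j) (F' i j) x :=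
  hasDerivAt_pi.1 (hasDerivAt_pi.1 h i) j

lemma Matrix.continuous_inv_of_det_ne_zero {N : ℕ} {F : ℝ → Matrix (Fin N) (Fin N) ℂ}
    (hF : Continuous F) (h : ∀ x, (F x).det ≠ 0) : Continuous fun x => (F x)⁻¹ := by
  simp only [Matrix.inv_def, Ring.inverse_eq_inv']
  rw [matrixNormTopology_eq] at hF ⊢
  exact (hF.matrix_det.inv₀ h).smul hF.matrix_adjugate

lemma intervalIntegrable_companionMatrix {N : ℕ} {v : Fin N → ℝ → ℂ}
    (hv : ∀ k s t, IntervalIntegrable (v k) volume s t) (z : ℂ) (s t : ℝ) :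
    IntervalIntegrable (companionMatrix v z) volume s t := by
  refine Matrix.intervalIntegrable_of_entries fun k l => ?_
  simp only [companionMatrix, Matrix.of_apply]
  split_ifs
  · exact (intervalIntegrable_const.sub (hv l s t)).const_mul _
  · exact (intervalIntegrable_const.sub (hv l s t)).const_mul _
  · exact intervalIntegrable_const
  · exact intervalIntegrable_const

lemma IsScalarSol.continuous_wronskianMatrix {N : ℕ} {v : Fin N → ℝ → ℂ} {z : ℂ}
    {w : Fin N → ℝ → ℂ} (hw : ∀ j, IsScalarSol N v z (w j)) : Continuous (wronskianMatrix w) := by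
  rw [matrixNormTopology_eq]
  refine continuous_matrix fun k j => ?_
  refine (hw j).1.continuous_iteratedDeriv (k : ℕ) ?_
  have : (k : ℕ) ≤ N - 1 := by omega
  exact_mod_cast this

lemma IsScalarSol.wronskianMatrix_sub {N : ℕ} {v : Fin N → ℝ → ℂ} {z : ℂ}
    (hv : ∀ k s t, IntervalIntegrable (v k) volume s t)
    {w : Fin N → ℝ → ℂ} (hw : ∀ j, IsScalarSol N v z (w j)) (x₀ x : ℝ) :
    wronskianMatrix w x - wronskianMatrix w x₀ =
      ∫ y in x₀..x, companionMatrix v z y * wronskianMatrix w y := by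
  have hint : IntervalIntegrable (fun y => companionMatrix v z y * wronskianMatrix w y)
      volume x₀ x :=
    (intervalIntegrable_companionMatrix hv z x₀ x).mul_continuousOn
      (IsScalarSol.continuous_wronskianMatrix hw).continuousOn
  ext k j
  rw [Matrix.intervalIntegral_apply hint, Matrix.sub_apply]
  obtain ⟨hsm, g, hg, hae⟩ := hw j
  by_cases hk : (k : ℕ) + 1 = N
  · have hk' : (k : ℕ) = N - 1 := by omega
    simp only [wronskianMatrix, Matrix.of_apply, hk']
    rw [hg x₀ x, add_sub_cancel_left]
    refine intervalIntegral.integral_congr_ae ?_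
    filter_upwards [hae] with y hy _
    have hpos : 0 < N := by omega
    have hz : ∑ l : Fin N, (if (l : ℕ) = 0 then z else 0) * iteratedDeriv l (w j) y =
        z * w j y := by
      rw [Finset.sum_eq_single ⟨0, hpos⟩]
      · simp
      · intro l _ hl
        have : (l : ℕ) ≠ 0 := fun h => hl (Fin.ext h)
        simp [this]
      · simp
    have hI : Complex.I ^ N * Complex.I ^ (-(N : ℤ)) = 1 := by
      rw [zpow_neg, zpow_natCast, mul_inv_cancel₀ (pow_ne_zero _ Complex.I_ne_zero)]
    simp only [Matrix.mul_apply, companionMatrix, Matrix.of_apply, if_pos hk]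
    have : ∑ l : Fin N, Complex.I ^ N * ((if (l : ℕ) = 0 then z else 0) - v l y) *
        iteratedDeriv l (w j) y =
          Complex.I ^ N * (z * w j y - ∑ l, v l y * iteratedDeriv l (w j) y) := by
      rw [← hz, ← Finset.sum_sub_distrib, Finset.mul_sum]
      exact Finset.sum_congr rfl fun l _ => by ring
    rw [this, ← hy, add_sub_cancel_right, ← mul_assoc, hI, one_mul]
  · have hk' : (k : ℕ) + 1 < N := by omega
    have hlt : ((k : ℕ) : WithTop ℕ∞) < ((N - 1 : ℕ) : WithTop ℕ∞) := by
      have : (k : ℕ) < N - 1 := by omega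
      exact_mod_cast this
    have hle : ((k + 1 : ℕ) : WithTop ℕ∞) ≤ ((N - 1 : ℕ) : WithTop ℕ∞) := by
      have : (k : ℕ) + 1 ≤ N - 1 := by omega
      exact_mod_cast this
    have heq : ∀ y, (companionMatrix v z y * wronskianMatrix w y) k j
        = iteratedDeriv (k + 1) (w j) y := by
      intro y
      simp only [Matrix.mul_apply, companionMatrix, wronskianMatrix, Matrix.of_apply, if_neg hk]
      rw [Finset.sum_eq_single ⟨k + 1, hk'⟩]
      · simp
      · intro l _ hl
        have : (l : ℕ) ≠ k + 1 := fun h => hl (Fin.ext h)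
        simp [this]
      · simp
    simp only [heq]
    rw [intervalIntegral.integral_eq_sub_of_hasDerivAt
      (f := iteratedDeriv k (w j))]
    · rfl
    · intro y _
      rw [iteratedDeriv_succ]
      exact (hsm.differentiable_iteratedDeriv (k : ℕ) hlt y).hasDerivAt
    · exact (hsm.continuous_iteratedDeriv _ hle).intervalIntegrable _ _

/-- The `z`-logarithmic derivative of a fundamental matrix is differentiable in `x`. -/
lemma hasDerivAt_wronskianMatrix_inv_mul {N : ℕ} {v : Fin N → ℝ → ℂ} {z : ℂ}
    (hv : ∀ k s t, IntervalIntegrable (v k) volume s t) {u : Fin N → ℝ → ℂ → ℂ}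
    (hu : ∀ᶠ z' in 𝓝 z, ∀ j, IsScalarSol N v z' (fun t => u j t z'))
    {U : ℝ → ℂ → Matrix (Fin N) (Fin N) ℂ}
    (hU : ∀ x z', U x z' = wronskianMatrix (fun j t => u j t z') x)
    (hdet : ∀ x, (U x z).det ≠ 0) {U' : ℝ → Matrix (Fin N) (Fin N) ℂ}
    (hU' : ∀ x, HasDerivAt (fun z' => U x z') (U' x) z) (x : ℝ) :
    HasDerivAt (fun y => (U y z)⁻¹ * U' y)
      ((U x z)⁻¹ * companionParamDeriv N * U x z) x := by
  have hUc : ∀ z', (∀ j, IsScalarSol N v z' (fun t => u j t z')) → Continuous fun x => U x z' := by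
    intro z' hz'
    simpa only [hU] using IsScalarSol.continuous_wronskianMatrix hz'
  have hUi : ∀ z', (∀ j, IsScalarSol N v z' (fun t => u j t z')) → ∀ x₀ x,
      U x z' - U x₀ z' = ∫ y in x₀..x, companionMatrix v z' y * U y z' := by
    intro z' hz'
    simpa only [hU] using IsScalarSol.wronskianMatrix_sub hv hz'
  have huz := hu.self_of_nhds
  have hPc := Matrix.continuous_inv_of_det_ne_zero (hUc z huz) hdet
  have hPU : ∀ x, (U x z)⁻¹ * U x z = 1 := fun x =>
    Matrix.nonsing_inv_mul _ (isUnit_iff_ne_zero.2 (hdet x))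
  have hUP : ∀ x, U x z * (U x z)⁻¹ = 1 := fun x =>
    Matrix.mul_nonsing_inv _ (isUnit_iff_ne_zero.2 (hdet x))
  refine hasDerivAt_deriv_param (z := z) (M := fun x z' => (U x z)⁻¹ * U x z')
    (B := fun x => (U x z)⁻¹ * companionParamDeriv N * U x z)
    ((hPc.mul continuous_const).mul (hUc z huz)) ?_ hPU (fun x => (hU' x).const_mul _) x
  filter_upwards [hu] with z' hz' x
  have hFc : Continuous fun y => (z' - z) • (companionParamDeriv N * U y z') :=
    Continuous.fun_const_smul (g := fun y => companionParamDeriv N * U y z')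
      (continuous_const.mul (hUc z' hz')) _
  have h := hasDerivAt_mul_of_integral_eq (A := companionMatrix v z)
    (F := fun y => (z' - z) • (companionParamDeriv N * U y z'))
    (U := fun x => U x z) (V := fun x => U x z') (P := fun x => (U x z)⁻¹)
    (intervalIntegrable_companionMatrix hv z) (fun s t => hFc.intervalIntegrable s t)
    (hUc z huz) (hUc z' hz') hPc hPU hUP x (hUi z huz x)
    (fun t => by
      rw [hUi z' hz' x t]
      refine intervalIntegral.integral_congr fun y _ => ?_
      simp only [companionMatrix_param v z z' y, add_mul, smul_mul_assoc]) hFc.continuousAt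
  convert h using 1
  rw [mul_smul_comm]
  congr 1
  rw [Matrix.mul_assoc _ (U x z),
    Matrix.mul_nonsing_inv_cancel_left _ _ (isUnit_iff_ne_zero.2 (hdet x)), Matrix.mul_assoc]

lemma Matrix.hasDerivAt_det_of_eq_one {N : ℕ} {M : ℂ → Matrix (Fin N) (Fin N) ℂ}
    {M' : Matrix (Fin N) (Fin N) ℂ} {z : ℂ} (hM : HasDerivAt M M' z) (h1 : M z = 1) :
    HasDerivAt (fun z' => (M z').det) M'.trace z := by
  simp only [Matrix.det_apply]
  have h := HasDerivAt.fun_sum (u := Finset.univ) (fun (σ : Equiv.Perm (Fin N)) _ =>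
    (HasDerivAt.fun_finsetProd (u := Finset.univ)
      (fun i _ => Matrix.hasDerivAt_apply hM (σ i) i)).const_smul (Equiv.Perm.sign σ))
  refine h.congr_deriv ?_
  rw [Finset.sum_eq_single (1 : Equiv.Perm (Fin N))]
  · simp [h1, Matrix.trace]
  · intro σ _ hσ
    refine smul_eq_zero_of_right _ (Finset.sum_eq_zero fun i _ => ?_)
    have : ∃ j, j ≠ i ∧ σ j ≠ j := by
      by_contra! hcon
      refine hσ (Equiv.ext fun j => ?_)
      by_cases hj : j = i
      · subst hj
        by_contra hne
        exact hne (σ.injective (hcon (σ j) hne))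
      · exact hcon j hj
    obtain ⟨j, hji, hj⟩ := this
    rw [Finset.prod_eq_zero (Finset.mem_erase.2 ⟨hji, Finset.mem_univ j⟩), zero_smul]
    rw [h1, Matrix.one_apply_ne hj]
  · simp

/-- Jacobi's formula. -/
lemma Matrix.hasDerivAt_det {N : ℕ} {F : ℂ → Matrix (Fin N) (Fin N) ℂ}
    {F' : Matrix (Fin N) (Fin N) ℂ} {z : ℂ} (hF : HasDerivAt F F' z) (h : (F z).det ≠ 0) :
    HasDerivAt (fun z' => (F z').det) ((F z).det * ((F z)⁻¹ * F').trace) z := by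
  have hu := isUnit_iff_ne_zero.2 h
  have h1 := (Matrix.hasDerivAt_det_of_eq_one (hF.const_mul (F z)⁻¹)
    (Matrix.nonsing_inv_mul _ hu)).const_mul (F z).det
  refine h1.congr_of_eventuallyEq (Eventually.of_forall fun z' => ?_)
  simp only [Matrix.det_mul, Matrix.det_nonsing_inv, Ring.inverse_eq_inv']
  field_simp

/-- Difference of the diagonal entries of two logarithmic derivatives in terms of the
off-diagonal blocks, when some columns of the two matrices agree. -/
lemma Matrix.diag_inv_mul_sub {N : ℕ} {U U₀ U' U₀' : Matrix (Fin N) (Fin N) ℂ}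
    (hU : U.det ≠ 0) (hU₀ : U₀.det ≠ 0) (p : Fin N → Prop) [DecidablePred p]
    (hcol : ∀ k i, p i → U k i = U₀ k i) (hcol' : ∀ k i, p i → U' k i = U₀' k i)
    {j : Fin N} (hj : p j) :
    (U⁻¹ * U') j j - (U₀⁻¹ * U₀') j j =
      ∑ i with ¬ p i, (U⁻¹ * U₀) j i * (U₀⁻¹ * U₀') i j := by
  have h1 : (U⁻¹ * U') j j = (U⁻¹ * U₀ * (U₀⁻¹ * U₀')) j j := by
    rw [Matrix.mul_assoc, Matrix.mul_nonsing_inv_cancel_left _ _ (isUnit_iff_ne_zero.2 hU₀)]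
    simp only [Matrix.mul_apply, hcol' _ j hj]
  have h2 : ∀ i, p i → (U⁻¹ * U₀) j i = (1 : Matrix (Fin N) (Fin N) ℂ) j i := by
    intro i hi
    rw [← Matrix.nonsing_inv_mul U (isUnit_iff_ne_zero.2 hU)]
    simp only [Matrix.mul_apply, hcol _ i hi]
  rw [h1, Matrix.mul_apply, ← Finset.sum_filter_add_sum_filter_not _ p, add_sub_right_comm,
    Finset.sum_congr rfl fun i hi => by rw [h2 i (Finset.mem_filter.1 hi).2]]
  rw [Finset.sum_eq_single j]
  · simp
  · intro i _ hij
    rw [Matrix.one_apply_ne hij.symm, zero_mul]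
  · intro h
    exact absurd (Finset.mem_filter.2 ⟨Finset.mem_univ j, hj⟩) h

lemma tendsto_sum_diag_inv_mul_sub {N : ℕ} {l : Filter ℝ}
    {U U₀ U' U₀' : ℝ → Matrix (Fin N) (Fin N) ℂ} {Q : Matrix (Fin N) (Fin N) ℂ}
    (hU : ∀ x, (U x).det ≠ 0) (hU₀ : ∀ x, (U₀ x).det ≠ 0) (p : Fin N → Prop) [DecidablePred p]
    (hcol : ∀ᶠ x in l, ∀ k i, p i → U x k i = U₀ x k i)
    (hcol' : ∀ᶠ x in l, ∀ k i, p i → U' x k i = U₀' x k i)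
    (hQ : ∀ᶠ x in l, (U x)⁻¹ * U₀ x = Q)
    (hdecay : ∀ i j, ¬ p i → p j → Tendsto (fun x => ((U₀ x)⁻¹ * U₀' x) i j) l (𝓝 0)) :
    Tendsto (fun x => ∑ j with p j, (((U x)⁻¹ * U' x) j j - ((U₀ x)⁻¹ * U₀' x) j j)) l (𝓝 0) := by
  have h : Tendsto (fun x => ∑ j with p j, ∑ i with ¬ p i, Q j i * ((U₀ x)⁻¹ * U₀' x) i j) l
      (𝓝 (∑ j : Fin N with p j, ∑ i : Fin N with ¬ p i, Q j i * 0)) :=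
    tendsto_finsetSum _ fun j hj => tendsto_finsetSum _ fun i hi =>
      (hdecay i j (Finset.mem_filter.1 hi).2 (Finset.mem_filter.1 hj).2).const_mul _
  simp only [mul_zero, Finset.sum_const_zero] at h
  refine h.congr' ?_
  filter_upwards [hcol, hcol', hQ] with x h1 h2 h3
  refine Finset.sum_congr rfl fun j hj => ?_
  rw [Matrix.diag_inv_mul_sub (hU x) (hU₀ x) p h1 h2 (Finset.mem_filter.1 hj).2, h3]

lemma iteratedDeriv_cexp_mul_ofReal (ζ : ℂ) (k : ℕ) :
    iteratedDeriv k (fun t : ℝ => Complex.exp (ζ * t)) =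
      fun t : ℝ => ζ ^ k * Complex.exp (ζ * t) := by
  induction k with
  | zero => simp
  | succ k ih =>
    rw [iteratedDeriv_succ, ih]
    funext t
    have h : HasDerivAt (fun t : ℝ => Complex.exp (ζ * t)) (Complex.exp (ζ * t) * (ζ * 1)) t :=
      ((Complex.ofRealCLM.hasDerivAt (x := t)).const_mul ζ).cexp
    rw [(h.const_mul (ζ ^ k)).deriv]
    ring

lemma isScalarSol_cexp {N : ℕ} (hN : 1 ≤ N) {ζ z : ℂ} (h : ζ ^ N = Complex.I ^ N * z) :
    IsScalarSol N (fun _ _ => 0) z (fun t => Complex.exp (ζ * t)) := by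
  have hsm : ContDiff ℝ ⊤ (fun t : ℝ => Complex.exp (ζ * t)) :=
    (contDiff_const.mul Complex.ofRealCLM.contDiff).cexp
  refine ⟨hsm.of_le le_top, fun t => ζ ^ N * Complex.exp (ζ * t), fun x₀ x => ?_,
    ae_of_all _ fun x => ?_⟩
  · have hd : ∀ t : ℝ, HasDerivAt (iteratedDeriv (N - 1) (fun t : ℝ => Complex.exp (ζ * t)))
        (ζ ^ N * Complex.exp (ζ * t)) t := by
      intro t
      have h1 := ((hsm.differentiable_iteratedDeriv (N - 1) (by
        exact_mod_cast WithTop.coe_lt_top _)) t).hasDerivAt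
      rw [← iteratedDeriv_succ, Nat.sub_add_cancel hN, iteratedDeriv_cexp_mul_ofReal ζ N] at h1
      exact h1
    rw [intervalIntegral.integral_eq_sub_of_hasDerivAt (fun t _ => hd t)
      (Continuous.intervalIntegrable (by fun_prop) _ _)]
    ring
  · have hI : Complex.I ^ (-(N : ℤ)) * Complex.I ^ N = 1 := by
      rw [zpow_neg, zpow_natCast, inv_mul_cancel₀ (pow_ne_zero _ Complex.I_ne_zero)]
    simp only [zero_mul, Finset.sum_const_zero, add_zero]
    rw [h, mul_assoc, ← mul_assoc, hI, one_mul]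

lemma tendsto_cexp_mul_atTop {c : ℂ} (hc : c.re < 0) :
    Tendsto (fun x : ℝ => Complex.exp (c * x)) atTop (𝓝 0) := by
  rw [tendsto_zero_iff_norm_tendsto_zero]
  simp only [Complex.norm_exp, Complex.re_mul_ofReal]
  exact Real.tendsto_exp_atBot.comp (tendsto_id.const_mul_atTop_of_neg hc)

lemma tendsto_cexp_mul_atBot {c : ℂ} (hc : 0 < c.re) :
    Tendsto (fun x : ℝ => Complex.exp (c * x)) atBot (𝓝 0) := by
  rw [tendsto_zero_iff_norm_tendsto_zero]
  simp only [Complex.norm_exp, Complex.re_mul_ofReal]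
  exact Real.tendsto_exp_atBot.comp (tendsto_id.const_mul_atBot hc)

/-- The Wronskian matrix of exponentials factors through a Vandermonde matrix. -/
lemma exp_wronskian_eq_vandermonde_mul {N : ℕ} (ζ : Fin N → ℂ) (x : ℝ) :
    (Matrix.of fun k j : Fin N => ζ j ^ (k : ℕ) * Complex.exp (ζ j * x)) =
      (Matrix.vandermonde ζ).transpose * Matrix.diagonal fun j => Complex.exp (ζ j * x) := by
  ext k j
  simp [Matrix.mul_diagonal, Matrix.vandermonde_apply]

lemma det_exp_wronskian_ne_zero {N : ℕ} {ζ : Fin N → ℂ} (hζ : Function.Injective ζ) (x : ℝ) :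
    (Matrix.of fun k j : Fin N => ζ j ^ (k : ℕ) * Complex.exp (ζ j * x)).det ≠ 0 := by
  rw [exp_wronskian_eq_vandermonde_mul, Matrix.det_mul, Matrix.det_transpose, Matrix.det_diagonal]
  exact mul_ne_zero (Matrix.det_vandermonde_ne_zero_iff.2 hζ)
    (Finset.prod_ne_zero_iff.2 fun j _ => Complex.exp_ne_zero _)

/-- Off-diagonal entries of the logarithmic derivative of the free fundamental matrix. -/
lemma exists_free_logDeriv_apply {N : ℕ} {ζ : Fin N → ℂ → ℂ} {z : ℂ}
    (hinj : Function.Injective fun j => ζ j z) (hζ : ∀ j, DifferentiableAt ℂ (ζ j) z)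
    {U₀ : ℝ → ℂ → Matrix (Fin N) (Fin N) ℂ}
    (hU₀ : ∀ x z', U₀ x z' =
      Matrix.of fun k j : Fin N => ζ j z' ^ (k : ℕ) * Complex.exp (ζ j z' * x))
    {U₀' : ℝ → Matrix (Fin N) (Fin N) ℂ}
    (hU₀' : ∀ x, HasDerivAt (fun z' => U₀ x z') (U₀' x) z) {i j : Fin N} (hij : i ≠ j) :
    ∃ C : ℂ, ∀ x : ℝ, ((U₀ x z)⁻¹ * U₀' x) i j = C * Complex.exp ((ζ j z - ζ i z) * x) := by
  set V : ℂ → Matrix (Fin N) (Fin N) ℂ := fun z' =>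
    (Matrix.vandermonde fun j => ζ j z').transpose with hV
  set V' : Matrix (Fin N) (Fin N) ℂ := Matrix.of fun k j => deriv (fun z' => ζ j z' ^ (k : ℕ)) z
    with hV'
  have hVd : HasDerivAt V V' z := Matrix.hasDerivAt_of_entries fun k j =>
    ((hζ j).pow (k : ℕ)).hasDerivAt
  refine ⟨((V z)⁻¹ * V') i j, fun x => ?_⟩
  set E : ℂ → Matrix (Fin N) (Fin N) ℂ := fun z' =>
    Matrix.diagonal fun j => Complex.exp (ζ j z' * x) with hE
  set L : Matrix (Fin N) (Fin N) ℂ := Matrix.diagonal fun j => deriv (ζ j) z * x with hL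
  have hEd : HasDerivAt E (E z * L) z := by
    refine Matrix.hasDerivAt_of_entries fun k l => ?_
    by_cases hkl : k = l
    · subst hkl
      simpa [hE, hL] using ((hζ k).hasDerivAt.mul_const (x : ℂ)).cexp
    · simpa [hE, hL, Matrix.diagonal_apply_ne _ hkl] using hasDerivAt_const z (0 : ℂ)
  have hfun : (fun z' => U₀ x z') = fun z' => V z' * E z' := by
    funext z'
    rw [hU₀, exp_wronskian_eq_vandermonde_mul]
  have hder : U₀' x = V' * E z + V z * (E z * L) := by
    have h1 := hU₀' x
    rw [hfun] at h1
    exact h1.unique (hVd.mul hEd)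
  set E' : Matrix (Fin N) (Fin N) ℂ := Matrix.diagonal fun j => Complex.exp (-(ζ j z * x)) with hE'
  have hEE' : E z * E' = 1 := by
    simp only [hE, hE', Matrix.diagonal_mul_diagonal, ← Complex.exp_add, add_neg_cancel,
      Complex.exp_zero, Matrix.diagonal_one]
  have hVu : IsUnit (V z).det := by
    rw [hV, Matrix.det_transpose]
    exact isUnit_iff_ne_zero.2 (Matrix.det_vandermonde_ne_zero_iff.2 hinj)
  have hUu : IsUnit (U₀ x z).det := by
    rw [hU₀]
    exact isUnit_iff_ne_zero.2 (det_exp_wronskian_ne_zero hinj x)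
  have hfac : U₀' x = U₀ x z * (E' * ((V z)⁻¹ * V') * E z + L) := by
    rw [hder, congrFun hfun z, Matrix.mul_add, Matrix.mul_assoc (V z) (E z) L]
    congr 1
    rw [Matrix.mul_assoc (V z), ← Matrix.mul_assoc (E z), ← Matrix.mul_assoc (E z) E', hEE',
      Matrix.one_mul, ← Matrix.mul_assoc (V z), Matrix.mul_nonsing_inv_cancel_left _ _ hVu]
  rw [hfac, Matrix.nonsing_inv_mul_cancel_left _ _ hUu, Matrix.add_apply, hL,
    Matrix.diagonal_apply_ne _ hij, add_zero, hE, Matrix.mul_diagonal, hE', Matrix.diagonal_mul,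
    sub_mul, sub_eq_add_neg, Complex.exp_add]
  ring

/-- Outside the support of the coefficients the transition matrix to the free system is
locally constant. -/
lemma hasDerivAt_inv_mul_free {N : ℕ} {v : Fin N → ℝ → ℂ} {z : ℂ}
    (hv : ∀ k s t, IntervalIntegrable (v k) volume s t) {w w₀ : Fin N → ℝ → ℂ}
    (hw : ∀ j, IsScalarSol N v z (w j)) (hw₀ : ∀ j, IsScalarSol N (fun _ _ => 0) z (w₀ j))
    (hdet : ∀ x, (wronskianMatrix w x).det ≠ 0) {x₀ : ℝ}
    (hx₀ : ∀ᶠ x in 𝓝 x₀, ∀ k, v k x = 0) :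
    HasDerivAt (fun x => (wronskianMatrix w x)⁻¹ * wronskianMatrix w₀ x) 0 x₀ := by
  have h0 : ∀ (k : Fin N) s t, IntervalIntegrable ((fun _ _ => 0 : Fin N → ℝ → ℂ) k) volume s t :=
    fun _ _ _ => intervalIntegrable_const
  have hc := IsScalarSol.continuous_wronskianMatrix hw
  have hc₀ := IsScalarSol.continuous_wronskianMatrix hw₀
  have hA := intervalIntegrable_companionMatrix hv z
  have hA₀ := intervalIntegrable_companionMatrix h0 z
  set F : ℝ → Matrix (Fin N) (Fin N) ℂ := fun y =>
    (companionMatrix (fun _ _ => 0) z y - companionMatrix v z y) * wronskianMatrix w₀ y with hF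
  have hF0 : F =ᶠ[𝓝 x₀] fun _ => 0 := by
    filter_upwards [hx₀] with y hy
    have : companionMatrix (fun _ _ => 0) z y = companionMatrix v z y := by
      ext k l
      simp [companionMatrix, hy]
    rw [hF]
    simp only [this, sub_self, zero_mul]
  have h := hasDerivAt_mul_of_integral_eq (A := companionMatrix v z) (F := F)
    (U := wronskianMatrix w) (V := wronskianMatrix w₀) (P := fun x => (wronskianMatrix w x)⁻¹)
    hA (fun s t => ((hA₀ s t).sub (hA s t)).mul_continuousOn hc₀.continuousOn) hc hc₀
    (Matrix.continuous_inv_of_det_ne_zero hc hdet)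
    (fun x => Matrix.nonsing_inv_mul _ (isUnit_iff_ne_zero.2 (hdet x)))
    (fun x => Matrix.mul_nonsing_inv _ (isUnit_iff_ne_zero.2 (hdet x))) x₀
    (IsScalarSol.wronskianMatrix_sub hv hw x₀)
    (fun t => by
      rw [IsScalarSol.wronskianMatrix_sub h0 hw₀ x₀ t]
      refine intervalIntegral.integral_congr fun y _ => ?_
      simp only [hF, sub_mul, add_sub_cancel])
    (continuousAt_const.congr hF0.symm)
  rwa [hF0.eq_of_nhds, mul_zero] at h

lemma inv_mul_companionParamDeriv_mul_apply {N : ℕ} (hN : 1 ≤ N)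
    (P U : Matrix (Fin N) (Fin N) ℂ) (i j : Fin N) :
    (P * companionParamDeriv N * U) i j =
      Complex.I ^ N * (U ⟨0, hN⟩ j * P i ⟨N - 1, by omega⟩) := by
  have h1 : ∀ l, (P * companionParamDeriv N) i l =
      if (l : ℕ) = 0 then P i ⟨N - 1, by omega⟩ * Complex.I ^ N else 0 := by
    intro l
    rw [Matrix.mul_apply, Finset.sum_eq_single ⟨N - 1, by omega⟩]
    · simp [companionParamDeriv, Nat.sub_add_cancel hN]
    · intro k _ hk
      have : (k : ℕ) + 1 ≠ N := fun h => hk (Fin.ext (by simp; omega))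
      simp [companionParamDeriv, this]
    · simp
  rw [Matrix.mul_apply, Finset.sum_eq_single ⟨0, hN⟩]
  · rw [h1]
    simp only [if_true]
    ring
  · intro l _ hl
    have : (l : ℕ) ≠ 0 := fun h => hl (Fin.ext h)
    rw [h1, if_neg this, zero_mul]
  · simp

lemma trace_inv_mul_companionParamDeriv_mul {N : ℕ} {U : Matrix (Fin N) (Fin N) ℂ}
    (hU : U.det ≠ 0) : (U⁻¹ * companionParamDeriv N * U).trace = (companionParamDeriv N).trace := by
  rw [Matrix.trace_mul_comm, Matrix.mul_nonsing_inv_cancel_left _ _ (isUnit_iff_ne_zero.2 hU)]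

/-- The logarithmic derivative of a matrix-valued function with respect to the spectral
parameter. -/
def logDerivMatrix {N : ℕ} (U : ℝ → ℂ → Matrix (Fin N) (Fin N) ℂ) (z : ℂ) (x : ℝ) :
    Matrix (Fin N) (Fin N) ℂ :=
  (U x z)⁻¹ * Matrix.of fun k j => deriv (fun z' => U x z' k j) z

lemma hasDerivAt_of_deriv_entries {N : ℕ} {U : ℝ → ℂ → Matrix (Fin N) (Fin N) ℂ} {z : ℂ}
    (hd : ∀ x k j, DifferentiableAt ℂ (fun z' => U x z' k j) z) (x : ℝ) :
    HasDerivAt (fun z' => U x z') (Matrix.of fun k j => deriv (fun z' => U x z' k j) z) z :=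
  Matrix.hasDerivAt_of_entries fun k j => (hd x k j).hasDerivAt

lemma hasDerivAt_det_logDerivMatrix {N : ℕ} {U : ℝ → ℂ → Matrix (Fin N) (Fin N) ℂ} {z : ℂ}
    (hd : ∀ x k j, DifferentiableAt ℂ (fun z' => U x z' k j) z)
    {x : ℝ} (hdet : (U x z).det ≠ 0) :
    HasDerivAt (fun z' => (U x z').det) ((U x z).det * (logDerivMatrix U z x).trace) z :=
  Matrix.hasDerivAt_det (hasDerivAt_of_deriv_entries hd x) hdet

lemma hasDerivAt_logDerivMatrix_apply {N : ℕ} (hN : 1 ≤ N) {v : Fin N → ℝ → ℂ} {z : ℂ}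
    (hv : ∀ k s t, IntervalIntegrable (v k) volume s t) {u : Fin N → ℝ → ℂ → ℂ}
    (hu : ∀ᶠ z' in 𝓝 z, ∀ j, IsScalarSol N v z' (fun t => u j t z'))
    {U : ℝ → ℂ → Matrix (Fin N) (Fin N) ℂ}
    (hU : ∀ x z', U x z' = wronskianMatrix (fun j t => u j t z') x)
    (hdet : ∀ x, (U x z).det ≠ 0)
    (hd : ∀ x k j, DifferentiableAt ℂ (fun z' => U x z' k j) z) (i j : Fin N) (x : ℝ) :
    HasDerivAt (fun y => logDerivMatrix U z y i j)
      (Complex.I ^ N * (U x z ⟨0, hN⟩ j * (U x z)⁻¹ i ⟨N - 1, by omega⟩)) x := by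
  rw [← inv_mul_companionParamDeriv_mul_apply hN]
  exact Matrix.hasDerivAt_apply
    (hasDerivAt_wronskianMatrix_inv_mul hv hu hU hdet (hasDerivAt_of_deriv_entries hd) x) i j

lemma continuous_wronskianMatrix_mul_inv {N : ℕ} {v : Fin N → ℝ → ℂ} {z : ℂ}
    {w : Fin N → ℝ → ℂ} (hw : ∀ j, IsScalarSol N v z (w j)) {U : ℝ → Matrix (Fin N) (Fin N) ℂ}
    (hU : ∀ x, U x = wronskianMatrix w x) (hdet : ∀ x, (U x).det ≠ 0) (i j k l : Fin N) :
    Continuous fun x => U x i j * (U x)⁻¹ k l := by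
  have hc : Continuous U := by
    rw [funext hU]
    exact IsScalarSol.continuous_wronskianMatrix hw
  have hci := Matrix.continuous_inv_of_det_ne_zero hc hdet
  rw [matrixNormTopology_eq] at hc hci
  exact (hc.matrix_elem i j).mul (hci.matrix_elem k l)

lemma hasDerivAt_trace_logDerivMatrix {N : ℕ} {v : Fin N → ℝ → ℂ} {z : ℂ}
    (hv : ∀ k s t, IntervalIntegrable (v k) volume s t) {u : Fin N → ℝ → ℂ → ℂ}
    (hu : ∀ᶠ z' in 𝓝 z, ∀ j, IsScalarSol N v z' (fun t => u j t z'))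
    {U : ℝ → ℂ → Matrix (Fin N) (Fin N) ℂ}
    (hU : ∀ x z', U x z' = wronskianMatrix (fun j t => u j t z') x)
    (hdet : ∀ x, (U x z).det ≠ 0)
    (hd : ∀ x k j, DifferentiableAt ℂ (fun z' => U x z' k j) z) (x : ℝ) :
    HasDerivAt (fun y => (logDerivMatrix U z y).trace) (companionParamDeriv N).trace x := by
  rw [← trace_inv_mul_companionParamDeriv_mul (hdet x)]
  exact HasDerivAt.fun_sum fun i _ => Matrix.hasDerivAt_apply
    (hasDerivAt_wronskianMatrix_inv_mul hv hu hU hdet (hasDerivAt_of_deriv_entries hd) x) i i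

/-- Where the coefficients vanish and the solutions with index in `p` are exponentials, the
corresponding part of the trace of the logarithmic derivative approaches the free one. -/
lemma tendsto_sum_logDerivMatrix_sub {N : ℕ} {v : Fin N → ℝ → ℂ} {z : ℂ}
    (hN : 1 ≤ N) (hv : ∀ k s t, IntervalIntegrable (v k) volume s t) {u : Fin N → ℝ → ℂ → ℂ}
    (hu : ∀ j, IsScalarSol N v z (fun t => u j t z))
    {U U₀ : ℝ → ℂ → Matrix (Fin N) (Fin N) ℂ}
    (hU : ∀ x z', U x z' = wronskianMatrix (fun j t => u j t z') x)
    (hdet : ∀ x, (U x z).det ≠ 0)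
    {ζ : Fin N → ℂ → ℂ} (hroot : ∀ j, ζ j z ^ N = Complex.I ^ N * z)
    (hinj : Function.Injective fun j => ζ j z) (hζ : ∀ j, DifferentiableAt ℂ (ζ j) z)
    (hU₀ : ∀ x z', U₀ x z' =
      Matrix.of fun k j : Fin N => ζ j z' ^ (k : ℕ) * Complex.exp (ζ j z' * x))
    {l : Filter ℝ} [l.NeBot] {s : Set ℝ} (hs : IsOpen s) (hs' : IsPreconnected s) (hsl : s ∈ l)
    (hv0 : ∀ x ∈ s, ∀ k, v k x = 0) (p : Fin N → Prop) [DecidablePred p]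
    (hbc : ∀ᶠ z' in 𝓝 z, ∀ j, p j → ∀ x ∈ s, u j x z' = Complex.exp (ζ j z' * x))
    (hdecay : ∀ i j, ¬ p i → p j →
      Tendsto (fun x : ℝ => Complex.exp ((ζ j z - ζ i z) * x)) l (𝓝 0)) :
    Tendsto (fun x => ∑ j with p j, (logDerivMatrix U z x j j - logDerivMatrix U₀ z x j j)) l
      (𝓝 0) := by
  have hU₀w : ∀ x z', U₀ x z' = wronskianMatrix (fun j t => Complex.exp (ζ j z' * t)) x := by
    intro x z'
    simp only [hU₀, wronskianMatrix, iteratedDeriv_cexp_mul_ofReal]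
  have hdet₀ : ∀ x, (U₀ x z).det ≠ 0 := fun x => by
    rw [hU₀]
    exact det_exp_wronskian_ne_zero hinj x
  have hd₀ : ∀ x k j, DifferentiableAt ℂ (fun z' => U₀ x z' k j) z := by
    intro x k j
    simp only [hU₀, Matrix.of_apply]
    have := hζ j
    fun_prop
  have hcol : ∀ᶠ z' in 𝓝 z, ∀ x ∈ s, ∀ k i, p i → U x z' k i = U₀ x z' k i := by
    filter_upwards [hbc] with z' hz' x hx k i hi
    simp only [hU, hU₀w, wronskianMatrix, Matrix.of_apply]
    refine Filter.EventuallyEq.iteratedDeriv_eq _ ?_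
    filter_upwards [hs.mem_nhds hx] with y hy using hz' i hi y hy
  obtain ⟨x₀, hx₀⟩ := Filter.nonempty_of_mem hsl
  have hQd : ∀ x ∈ s, HasDerivAt (fun y => (U y z)⁻¹ * U₀ y z) 0 x := by
    intro x hx
    simp only [hU, hU₀w]
    refine hasDerivAt_inv_mul_free hv hu (fun j => isScalarSol_cexp hN (hroot j))
      (fun y => by simpa only [hU] using hdet y) ?_
    filter_upwards [hs.mem_nhds hx] with y hy using hv0 y hy
  have hQ : ∀ x ∈ s, (U x z)⁻¹ * U₀ x z = (U x₀ z)⁻¹ * U₀ x₀ z := fun x hx =>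
    hs.is_const_of_deriv_eq_zero hs'
      (fun y hy => (hQd y hy).differentiableAt.differentiableWithinAt)
      (fun y hy => (hQd y hy).deriv) hx hx₀
  refine tendsto_sum_diag_inv_mul_sub (Q := (U x₀ z)⁻¹ * U₀ x₀ z) hdet hdet₀ p ?_ ?_ ?_ ?_
  · filter_upwards [hsl] with x hx using hcol.self_of_nhds x hx
  · filter_upwards [hsl] with x hx k i hi
    refine Filter.EventuallyEq.deriv_eq ?_
    filter_upwards [hcol] with z' hz' using hz' x hx k i hi
  · filter_upwards [hsl] with x hx using hQ x hx
  · intro i j hi hj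
    have hij : i ≠ j := fun h => hi (h ▸ hj)
    obtain ⟨C, hC⟩ := exists_free_logDeriv_apply hinj hζ hU₀ (hasDerivAt_of_deriv_entries hd₀) hij
    simpa only [hC, mul_zero] using (hdecay i j hi hj).const_mul C

end MatrixSystem

/-- trace formula, compactly supported coefficients: with `Δ(x,z) = W(x,z)/W₀(x,z)`
the normalized Wronskian, for every `x` the limit
`lim_{x₁→−∞, x₂→+∞} ∫_{x₁}^{x₂} (R(y,y,z) − R₀(y,y,z)) dy` exists and equals
`−Δ(x,z)⁻¹ ∂Δ(x,z)/∂z`. -/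
theorem statement_12 (N n : ℕ) (hN : 1 ≤ N) (hn : n ≤ N) (z : ℂ)
    (hadm : (Even N → ¬(z.im = 0 ∧ 0 ≤ z.re)) ∧ (¬ Even N → z.im ≠ 0))
    (Ω : Set ℂ) (hΩ : IsOpen Ω) (hzΩ : z ∈ Ω)
    (ζ : Fin N → ℂ → ℂ)
    (hroot : ∀ j : Fin N, ∀ z' ∈ Ω, ζ j z' ^ N = Complex.I ^ N * z')
    (hζdiff : ∀ j : Fin N, DifferentiableOn ℂ (ζ j) Ω)
    (hdist : ∀ z' ∈ Ω, Function.Injective fun j => ζ j z')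
    (hpos : ∀ z' ∈ Ω, ∀ j : Fin N, (j : ℕ) < n → 0 < (ζ j z').re)
    (hneg : ∀ z' ∈ Ω, ∀ j : Fin N, n ≤ (j : ℕ) → (ζ j z').re < 0)
    (a : ℝ) (ha : 0 < a)
    (v : Fin N → ℝ → ℂ)
    (hv : ∀ k : Fin N, MeasureTheory.LocallyIntegrable (v k))
    (hvsupp : ∀ k : Fin N, ∀ x : ℝ, x ∉ Set.Icc (-a) a → v k x = 0)
    (u : Fin N → ℝ → ℂ → ℂ)
    (husol : ∀ j : Fin N, ∀ z' ∈ Ω, IsScalarSol N v z' (fun t => u j t z'))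
    (hbcm : ∀ z' ∈ Ω, ∀ j : Fin N, (j : ℕ) < n → ∀ x : ℝ, x < -a →
      u j x z' = Complex.exp (ζ j z' * x))
    (hbcp : ∀ z' ∈ Ω, ∀ j : Fin N, n ≤ (j : ℕ) → ∀ x : ℝ, x > a →
      u j x z' = Complex.exp (ζ j z' * x))
    (U : ℝ → ℂ → Matrix (Fin N) (Fin N) ℂ)
    (hU : ∀ x : ℝ, ∀ z' : ℂ,
      U x z' = Matrix.of fun k j : Fin N => iteratedDeriv k (fun t => u j t z') x)
    (hdet : ∀ x : ℝ, (U x z).det ≠ 0)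
    (hUdiff : ∀ x : ℝ, ∀ k j : Fin N, DifferentiableOn ℂ (fun z' => U x z' k j) Ω)
    (U₀ : ℝ → ℂ → Matrix (Fin N) (Fin N) ℂ)
    (hU₀ : ∀ x : ℝ, ∀ z' : ℂ,
      U₀ x z' = Matrix.of fun k j : Fin N => ζ j z' ^ (k : ℕ) * Complex.exp (ζ j z' * x))
    (R R₀ : ℝ → ℝ → ℂ)
    (hR : ∀ x y : ℝ, R x y =
      if x < y then
        -Complex.I ^ (N : ℕ) * ∑ j ∈ Finset.univ.filter (fun j : Fin N => (j : ℕ) < n),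
          u j x z * (U y z)⁻¹ j ⟨N - 1, by omega⟩
      else
        Complex.I ^ (N : ℕ) * ∑ j ∈ Finset.univ.filter (fun j : Fin N => n ≤ (j : ℕ)),
          u j x z * (U y z)⁻¹ j ⟨N - 1, by omega⟩)
    (hR₀ : ∀ x y : ℝ, R₀ x y =
      if x < y then
        -Complex.I ^ (N : ℕ) * ∑ j ∈ Finset.univ.filter (fun j : Fin N => (j : ℕ) < n),
          Complex.exp (ζ j z * x) * (U₀ y z)⁻¹ j ⟨N - 1, by omega⟩
      else
        Complex.I ^ (N : ℕ) * ∑ j ∈ Finset.univ.filter (fun j : Fin N => n ≤ (j : ℕ)),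
          Complex.exp (ζ j z * x) * (U₀ y z)⁻¹ j ⟨N - 1, by omega⟩)
    (Δ : ℝ → ℂ → ℂ)
    (hΔ : ∀ x : ℝ, ∀ z' : ℂ, Δ x z' = (U x z').det / (U₀ x z').det) :
    ∀ x : ℝ,
      Filter.Tendsto (fun q : ℝ × ℝ => ∫ y in q.1..q.2, (R y y - R₀ y y))
        (Filter.atBot ×ˢ Filter.atTop)
        (nhds (-(Δ x z)⁻¹ * deriv (fun z' => Δ x z') z)) := by

  have hΩz : Ω ∈ 𝓝 z := hΩ.mem_nhds hzΩ
  have hvi : ∀ k s t, IntervalIntegrable (v k) volume s t := fun k s t =>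
    ((hv k).integrableOn_isCompact isCompact_uIcc).intervalIntegrable
  have hζ : ∀ j, DifferentiableAt ℂ (ζ j) z := fun j => (hζdiff j).differentiableAt hΩz
  have hinj := hdist z hzΩ
  have hu : ∀ᶠ z' in 𝓝 z, ∀ j, IsScalarSol N v z' (fun t => u j t z') := by
    filter_upwards [hΩz] with z' hz' j using husol j z' hz'
  have hu₀ : ∀ᶠ z' in 𝓝 z, ∀ j,
      IsScalarSol N (fun _ _ => 0) z' (fun t : ℝ => Complex.exp (ζ j z' * t)) := by
    filter_upwards [hΩz] with z' hz' j using isScalarSol_cexp hN (hroot j z' hz')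
  have hU₀w : ∀ x z', U₀ x z' = wronskianMatrix (fun j t => Complex.exp (ζ j z' * t)) x := by
    intro x z'
    simp only [hU₀, wronskianMatrix, iteratedDeriv_cexp_mul_ofReal]
  have hdet₀ : ∀ x, (U₀ x z).det ≠ 0 := fun x => by
    rw [hU₀]
    exact det_exp_wronskian_ne_zero hinj x
  have hd : ∀ x k j, DifferentiableAt ℂ (fun z' => U x z' k j) z := fun x k j =>
    (hUdiff x k j).differentiableAt hΩz
  have hd₀ : ∀ x k j, DifferentiableAt ℂ (fun z' => U₀ x z' k j) z := by
    intro x k j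
    simp only [hU₀, Matrix.of_apply]
    have := hζ j
    fun_prop
  have hD := hasDerivAt_logDerivMatrix_apply hN hvi hu hU hdet hd
  have hD₀ := hasDerivAt_logDerivMatrix_apply hN (fun _ _ _ => intervalIntegrable_const) hu₀ hU₀w
    hdet₀ hd₀
  have htr := hasDerivAt_trace_logDerivMatrix hvi hu hU hdet hd
  have htr₀ := hasDerivAt_trace_logDerivMatrix (fun _ _ _ => intervalIntegrable_const) hu₀ hU₀w
    hdet₀ hd₀
  intro x
  set L : ℂ := (logDerivMatrix U z x).trace - (logDerivMatrix U₀ z x).trace with hL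
  have hLc : ∀ y, (logDerivMatrix U z y).trace - (logDerivMatrix U₀ z y).trace = L := by
    intro y
    have h : ∀ y, HasDerivAt
        (fun y => (logDerivMatrix U z y).trace - (logDerivMatrix U₀ z y).trace) 0 y := fun y =>
      ((htr y).sub (htr₀ y)).congr_deriv (sub_self _)
    exact is_const_of_deriv_eq_zero (fun y => (h y).differentiableAt) (fun y => (h y).deriv) y x
  have hval : (Δ x z)⁻¹ * deriv (fun z' => Δ x z') z = L := by
    have h := (hasDerivAt_det_logDerivMatrix hd (hdet x)).div
      (hasDerivAt_det_logDerivMatrix hd₀ (hdet₀ x)) (hdet₀ x)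
    have hΔx : (fun z' => Δ x z') = (fun z' => (U x z').det) / fun z' => (U₀ x z').det :=
      funext (hΔ x)
    rw [hΔx, h.deriv, hΔ, hL]
    have h1 := hdet x
    have h2 := hdet₀ x
    field_simp
  set d : Fin N → ℝ → ℂ := fun j y => logDerivMatrix U z y j j - logDerivMatrix U₀ z y j j with hdd
  set S : ℝ → ℂ := fun y => ∑ j ∈ Finset.univ.filter (fun j : Fin N => n ≤ (j : ℕ)), d j y with hS
  have hsplit : ∀ y, S y = L - ∑ j ∈ Finset.univ.filter (fun j : Fin N => (j : ℕ) < n), d j y := by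
    intro y
    rw [eq_sub_iff_add_eq, add_comm, ← hLc y, Matrix.trace, Matrix.trace,
      ← Finset.sum_sub_distrib,
      ← Finset.sum_filter_add_sum_filter_not Finset.univ (fun j : Fin N => (j : ℕ) < n)]
    simp only [not_lt, hS, hdd, Matrix.diag_apply]
  have hRS : ∀ y, R y y - R₀ y y =
      ∑ j ∈ Finset.univ.filter (fun j : Fin N => n ≤ (j : ℕ)),
        (Complex.I ^ N * (U y z ⟨0, hN⟩ j * (U y z)⁻¹ j ⟨N - 1, by omega⟩) -
          Complex.I ^ N * (U₀ y z ⟨0, hN⟩ j * (U₀ y z)⁻¹ j ⟨N - 1, by omega⟩)) := by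
    intro y
    rw [hR, hR₀, if_neg (lt_irrefl y), if_neg (lt_irrefl y), Finset.sum_sub_distrib,
      ← Finset.mul_sum, ← Finset.mul_sum]
    congr 2
    · exact Finset.sum_congr rfl fun j _ => by simp [hU]
    · exact Finset.sum_congr rfl fun j _ => by simp [hU₀]
  have hSd : ∀ y, HasDerivAt S (R y y - R₀ y y) y := by
    intro y
    rw [hRS]
    exact HasDerivAt.fun_sum fun j _ => (hD j j y).fun_sub (hD₀ j j y)
  have hRc : Continuous fun y => R y y - R₀ y y := by
    simp only [hRS]
    exact continuous_finsetSum _ fun j _ =>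
      (continuous_const.mul (continuous_wronskianMatrix_mul_inv (fun j => husol j z hzΩ)
        (fun y => hU y z) hdet _ _ _ _)).sub
      (continuous_const.mul (continuous_wronskianMatrix_mul_inv hu₀.self_of_nhds
        (fun y => hU₀w y z) hdet₀ _ _ _ _))
  have hint : ∀ q : ℝ × ℝ, ∫ y in q.1..q.2, (R y y - R₀ y y) = S q.2 - S q.1 := fun q =>
    intervalIntegral.integral_eq_sub_of_hasDerivAt (fun y _ => hSd y)
      (hRc.intervalIntegrable _ _)
  have htop : Tendsto S atTop (𝓝 0) := by
    refine tendsto_sum_logDerivMatrix_sub hN hvi (fun j => husol j z hzΩ) hU hdet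
      (fun j => hroot j z hzΩ) hinj hζ hU₀ isOpen_Ioi isPreconnected_Ioi (Ioi_mem_atTop a) ?_
      (fun j => n ≤ (j : ℕ)) ?_ ?_
    · intro y hy k
      exact hvsupp k y fun h => absurd h.2 (not_le.2 hy)
    · filter_upwards [hΩz] with z' hz' j hj y hy using hbcp z' hz' j hj y hy
    · intro i j hi hj
      refine tendsto_cexp_mul_atTop ?_
      have h1 := hneg z hzΩ j hj
      have h2 := hpos z hzΩ i (not_le.1 hi)
      rw [Complex.sub_re]
      linarith
  have hbot : Tendsto S atBot (𝓝 L) := by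
    have h : Tendsto (fun y => ∑ j ∈ Finset.univ.filter (fun j : Fin N => (j : ℕ) < n), d j y)
        atBot (𝓝 0) := by
      refine tendsto_sum_logDerivMatrix_sub hN hvi (fun j => husol j z hzΩ) hU hdet
        (fun j => hroot j z hzΩ) hinj hζ hU₀ isOpen_Iio isPreconnected_Iio (Iio_mem_atBot (-a)) ?_
        (fun j => (j : ℕ) < n) ?_ ?_
      · intro y hy k
        exact hvsupp k y fun h => absurd h.1 (not_le.2 hy)
      · filter_upwards [hΩz] with z' hz' j hj y hy using hbcm z' hz' j hj y hy
      · intro i j hi hj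
        refine tendsto_cexp_mul_atBot ?_
        have h1 := hneg z hzΩ i (not_lt.1 hi)
        have h2 := hpos z hzΩ j hj
        rw [Complex.sub_re]
        linarith
    simpa only [← hsplit, sub_zero] using h.const_sub L
  rw [neg_mul, hval, ← zero_sub]
  simp only [hint]
  exact (htop.comp tendsto_snd).sub (hbot.comp tendsto_fst)
end
end
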